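/- For every integer n ≥ 1, the number N of fully commutative involutions in the Coxeter group of type D_{n+1} satisfies: N = 2^n + C(n+1, n/2) − 1 if n is even, and 2·N = 2^{n+1} + 3·C(n+1, (n+1)/2) − 2 if n is odd (equivalently N = 2^n + (3/2)·C(n+1,(n+1)/2) − 1, the central binomial coefficient being even). -/

import Mathlib

open CoxeterSystem

/-- A single commutation move: transposition of two adjacent letters `a`, `b`
with `M a b = 2`. -/
def CommMove {B : Type*} (M : CoxeterMatrix B) (w w' : List B) : Prop :=
  ∃ (u v : List B) (a b : B), M a b = 2 ∧ w = u ++ a :: b :: v ∧ w' = u ++ b :: a :: v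

/-- Commutation equivalence of words: two words are commutation-equivalent if one can be
obtained from the other by a sequence of transpositions of adjacent commuting letters. -/
def CommEquiv {B : Type*} (M : CoxeterMatrix B) : List B → List B → Prop :=
  Relation.EqvGen (CommMove M)

/-- An element is fully commutative if all its reduced words are commutation-equivalent. -/
def IsFullyCommutative {B W : Type*} [Group W] {M : CoxeterMatrix B}
    (cs : CoxeterSystem M W) (w : W) : Prop :=
  ∀ u v : List B, cs.IsReduced u → cs.wordProd u = w →
    cs.IsReduced v → cs.wordProd v = w → CommEquiv M u v

/-- A fully commutative involution (the identity is allowed). -/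
def IsFCInvolution {B W : Type*} [Group W] {M : CoxeterMatrix B}
    (cs : CoxeterSystem M W) (w : W) : Prop :=
  IsFullyCommutative cs w ∧ w * w = 1

/-- The Coxeter matrix of type `D_{n+1}`: generators `s_1, …, s_{n+1}` (index `k : Fin (n+1)`
corresponds to `s_{k+1}`), with `m(s_i, s_{i+1}) = 3` for `1 ≤ i ≤ n-1`,
`m(s_{n-1}, s_{n+1}) = 3`, `m(s_n, s_{n+1}) = 2`, and `m(s_i, s_j) = 2` for all
other pairs `i ≠ j`. -/
def typeD (n : ℕ) : CoxeterMatrix (Fin (n + 1)) where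
  M := Matrix.of fun i j : Fin (n + 1) =>
    if (i : ℕ) = (j : ℕ) then 1
    else if ((i : ℕ) + 1 = (j : ℕ) ∧ (j : ℕ) < n) ∨ ((j : ℕ) + 1 = (i : ℕ) ∧ (i : ℕ) < n)
        ∨ ((i : ℕ) + 2 = n ∧ (j : ℕ) = n) ∨ ((j : ℕ) + 2 = n ∧ (i : ℕ) = n) then 3
    else 2
  isSymm := by
    ext i j
    simp only [Matrix.transpose_apply, Matrix.of_apply]
    split_ifs <;> omega
  diagonal := by intro i; simp [Matrix.of_apply]
  off_diagonal := by
    intro i j hij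
    have h : (i : ℕ) ≠ (j : ℕ) := fun h => hij (Fin.ext h)
    simp only [Matrix.of_apply]
    split_ifs <;> omega

section Exchange

variable {B W : Type*} [Group W] {M : CoxeterMatrix B} (cs : CoxeterSystem M W)

/-- A Coxeter matrix all of whose off-diagonal entries are `2` or `3`. -/
def CoxeterMatrix.IsSimplyLaced (M : CoxeterMatrix B) : Prop :=
  ∀ i j, i ≠ j → M i j = 2 ∨ M i j = 3

namespace CoxeterSystem

theorem End.mul_apply {α : Type*} (f g : Function.End α) (x : α) : (f * g) x = f (g x) := rfl

theorem End.one_apply {α : Type*} (x : α) : (1 : Function.End α) x = x := rfl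

open Classical in
/-- The indicator function of equality, with values in `ZMod 2`. -/
noncomputable def eqIndicator (a b : W) : ZMod 2 := if a = b then 1 else 0

/-- Conjugation by a simple reflection on `W`, together with a sign recording whether the
argument is that reflection. -/
noncomputable def signedConj (i : B) : Function.End (W × ZMod 2) := fun p =>
  (cs.simple i * p.1 * cs.simple i, p.2 + eqIndicator p.1 (cs.simple i))

theorem simple_commute {i j : B} (h : M i j = 2) :
    cs.simple i * cs.simple j = cs.simple j * cs.simple i := by
  have h1 := cs.simple_mul_simple_pow i j
  rw [h, pow_two] at h1
  have := mul_eq_one_iff_eq_inv.mp h1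
  simpa using this

theorem simple_braid {i j : B} (h : M i j = 3) :
    cs.simple i * cs.simple j * cs.simple i = cs.simple j * cs.simple i * cs.simple j := by
  have h1 := cs.simple_mul_simple_pow i j
  rw [h, pow_succ, pow_two] at h1
  have h2 : (cs.simple i * cs.simple j * cs.simple i) *
      (cs.simple j * cs.simple i * cs.simple j) = 1 := by simpa [mul_assoc] using h1
  simpa [mul_assoc] using mul_eq_one_iff_eq_inv.mp h2

theorem eqIndicator_simple_mul (i : B) (a b : W) :
    eqIndicator (cs.simple i * a) b = eqIndicator a (cs.simple i * b) := by
  have : cs.simple i * a = b ↔ a = cs.simple i * b := by constructor <;> rintro rfl <;> simp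
  unfold eqIndicator
  split_ifs <;> tauto

theorem eqIndicator_mul_simple (i : B) (a b : W) :
    eqIndicator (a * cs.simple i) b = eqIndicator a (b * cs.simple i) := by
  have : a * cs.simple i = b ↔ a = b * cs.simple i := by constructor <;> rintro rfl <;> simp
  unfold eqIndicator
  split_ifs <;> tauto

theorem isLiftable_signedConj (hM : M.IsSimplyLaced) : M.IsLiftable cs.signedConj := by
  intro i j
  by_cases hij : i = j
  · subst hij
    funext ⟨r, e⟩
    rw [M.diagonal, pow_one]
    ext
    · simp [End.mul_apply, End.one_apply, signedConj, mul_assoc]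
    · simp [End.mul_apply, End.one_apply, signedConj, eqIndicator_simple_mul,
        eqIndicator_mul_simple, add_assoc, CharTwo.add_self_eq_zero]
  · rcases hM i j hij with h | h
    · have hc := cs.simple_commute h
      have h' (a : W) : cs.simple i * (cs.simple j * a) = cs.simple j * (cs.simple i * a) := by
        rw [← mul_assoc, hc, mul_assoc]
      funext ⟨r, e⟩
      rw [h, pow_two]
      ext
      · simp [End.mul_apply, End.one_apply, signedConj, mul_assoc, h', hc]
      · simp only [End.mul_apply, End.one_apply, signedConj, eqIndicator_simple_mul,
          eqIndicator_mul_simple]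
        simp only [h', hc, cs.simple_mul_simple_cancel_left,
          cs.simple_mul_simple_self, mul_one]
        ring_nf
        simp [show (2 : ZMod 2) = 0 from rfl]
    · have hc := cs.simple_braid h
      simp only [mul_assoc] at hc
      have h' (a : W) : cs.simple i * (cs.simple j * (cs.simple i * a)) =
          cs.simple j * (cs.simple i * (cs.simple j * a)) := by
        rw [← mul_assoc, ← mul_assoc, mul_assoc (cs.simple i), hc]; simp only [mul_assoc]
      funext ⟨r, e⟩
      rw [h, pow_succ, pow_two]
      ext
      · simp [End.mul_apply, End.one_apply, signedConj, mul_assoc, h', hc]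
      · simp only [End.mul_apply, End.one_apply, signedConj, eqIndicator_simple_mul,
          eqIndicator_mul_simple]
        simp only [mul_assoc, hc, cs.simple_mul_simple_cancel_left,
          cs.simple_mul_simple_self, mul_one]
        ring_nf
        simp [show (2 : ZMod 2) = 0 from rfl]

open Classical in
theorem lift_signedConj_wordProd (hM : M.IsSimplyLaced) (ω : List B) (p : W × ZMod 2) :
    cs.lift ⟨_, cs.isLiftable_signedConj hM⟩ (cs.wordProd ω) p =
      (cs.wordProd ω * p.1 * (cs.wordProd ω)⁻¹, p.2 + ((cs.rightInvSeq ω).count p.1 : ZMod 2)) := by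
  induction ω with
  | nil => simp [End.one_apply]
  | cons i ω ih =>
    rw [cs.wordProd_cons, map_mul, End.mul_apply, ih, lift_apply_simple]
    simp only [signedConj, eqIndicator, rightInvSeq, List.count_cons]
    ext
    · simp [mul_assoc]
    · have : cs.wordProd ω * p.1 * (cs.wordProd ω)⁻¹ = cs.simple i ↔
          (cs.wordProd ω)⁻¹ * cs.simple i * cs.wordProd ω = p.1 := by
        rw [mul_inv_eq_iff_eq_mul, mul_assoc, inv_mul_eq_iff_eq_mul, eq_comm]
      by_cases hc : (cs.wordProd ω)⁻¹ * cs.simple i * cs.wordProd ω = p.1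
      · simp [this, hc, add_assoc]
      · simp [this, hc]

theorem exchange (hM : M.IsSimplyLaced) (ω : List B) (i : B)
    (h : cs.IsRightDescent (cs.wordProd ω) i) :
    ∃ j < ω.length, cs.wordProd ω * cs.simple i = cs.wordProd (ω.eraseIdx j) := by
  classical
  obtain ⟨τ, hτ, hτw⟩ := cs.exists_isReduced (cs.wordProd ω * cs.simple i)
  have hprod : cs.wordProd (τ.concat i) = cs.wordProd ω := by
    rw [wordProd_concat, ← hτw]; simp
  have hred : cs.IsReduced (τ.concat i) := by
    unfold IsReduced at *
    rw [hprod, List.length_concat, ← hτ, ← hτw]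
    exact ((cs.isRightDescent_iff).1 h).symm
  have hcount : (cs.rightInvSeq (τ.concat i)).count (cs.simple i) = 1 := by
    refine List.count_eq_one_of_mem hred.nodup_rightInvSeq ?_
    rw [rightInvSeq_concat]; simp
  have key := cs.lift_signedConj_wordProd hM ω (cs.simple i, 0)
  rw [← hprod, cs.lift_signedConj_wordProd hM (τ.concat i), hcount] at key
  have hmem : cs.simple i ∈ cs.rightInvSeq ω := by
    by_contra hn
    rw [List.count_eq_zero_of_not_mem hn] at key
    simp at key
  obtain ⟨j, hj, hji⟩ := List.getElem_of_mem hmem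
  refine ⟨j, by simpa using hj, ?_⟩
  rw [← cs.wordProd_mul_getD_rightInvSeq, List.getD_eq_getElem _ _ hj, hji]

theorem exists_isReduced_concat {w : W} {s : B} (h : cs.IsRightDescent w s) :
    ∃ τ, cs.IsReduced τ ∧ cs.wordProd τ = w * cs.simple s ∧ cs.IsReduced (τ ++ [s]) ∧
      cs.wordProd (τ ++ [s]) = w := by
  obtain ⟨τ, hτ, hτw⟩ := cs.exists_isReduced (w * cs.simple s)
  have hw : cs.wordProd (τ ++ [s]) = w := by
    rw [cs.wordProd_append, ← hτw]; simp
  refine ⟨τ, hτ, hτw.symm, ?_, hw⟩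
  rw [isRightDescent_iff] at h
  unfold IsReduced
  rw [hw, ← h, hτw, hτ.eq]; simp

theorem IsReduced.isRightDescent {cs : CoxeterSystem M W} {τ : List B} {s : B}
    (h : cs.IsReduced (τ ++ [s])) : cs.IsRightDescent (cs.wordProd (τ ++ [s])) s := by
  unfold IsRightDescent
  rw [h.eq, cs.wordProd_append]
  have := cs.length_wordProd_le τ
  simp
  omega

theorem IsReduced.of_concat {cs : CoxeterSystem M W} {τ : List B} {s : B}
    (h : cs.IsReduced (τ ++ [s])) : cs.IsReduced τ := by
  simpa using h.take τ.length

end CoxeterSystem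

end Exchange

section BraidFree

variable {B W : Type*} [Group W] {M : CoxeterMatrix B}

namespace CommEquiv

theorem refl (u : List B) : CommEquiv M u u := Relation.EqvGen.refl u

theorem symm {u v : List B} (h : CommEquiv M u v) : CommEquiv M v u := Relation.EqvGen.symm _ _ h

theorem trans {u v w : List B} (h : CommEquiv M u v) (h' : CommEquiv M v w) : CommEquiv M u w :=
  Relation.EqvGen.trans _ _ _ h h'

theorem of_map_eq {α : Type*} {f : List B → α} (hf : ∀ u v, CommMove M u v → f u = f v)
    {u v : List B} (h : CommEquiv M u v) : f u = f v := by
  induction h with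
  | rel u v h => exact hf u v h
  | refl u => rfl
  | symm u v _ ih => exact ih.symm
  | trans u v w _ _ ih ih' => exact ih.trans ih'

theorem append_append (x y : List B) {u v : List B} (h : CommEquiv M u v) :
    CommEquiv M (x ++ u ++ y) (x ++ v ++ y) := by
  induction h with
  | rel u v h =>
    obtain ⟨p, q, a, b, hab, rfl, rfl⟩ := h
    exact Relation.EqvGen.rel _ _ ⟨x ++ p, q ++ y, a, b, hab, by simp, by simp⟩
  | refl u => exact refl _
  | symm u v _ ih => exact ih.symm
  | trans u v w _ _ ih ih' => exact ih.trans ih'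

theorem append_left (x : List B) {u v : List B} (h : CommEquiv M u v) :
    CommEquiv M (x ++ u) (x ++ v) := by simpa using h.append_append x []

theorem append_right (y : List B) {u v : List B} (h : CommEquiv M u v) :
    CommEquiv M (u ++ y) (v ++ y) := by simpa using h.append_append [] y

theorem cons (a : B) {u v : List B} (h : CommEquiv M u v) : CommEquiv M (a :: u) (a :: v) :=
  h.append_left [a]

theorem swap {a b : B} (h : M a b = 2) (x y : List B) :
    CommEquiv M (x ++ a :: b :: y) (x ++ b :: a :: y) :=
  Relation.EqvGen.rel _ _ ⟨x, y, a, b, h, rfl, rfl⟩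

theorem cons_append_of_commute {s : B} {y : List B} (h : ∀ b ∈ y, M s b = 2) (z : List B) :
    CommEquiv M (s :: (y ++ z)) (y ++ s :: z) := by
  induction y with
  | nil => exact refl _
  | cons b y ih =>
    refine (swap (h b (by simp)) [] (y ++ z)).trans ?_
    exact (ih fun c hc => h c (by simp [hc])).cons b

theorem perm {u v : List B} (h : CommEquiv M u v) : u.Perm v := by
  induction h with
  | rel u v h =>
    obtain ⟨p, q, a, b, hab, rfl, rfl⟩ := h
    exact (List.Perm.swap b a q).append_left p
  | refl u => exact .refl _
  | symm u v _ ih => exact ih.symm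
  | trans u v w _ _ ih ih' => exact ih.trans ih'

theorem wordProd_eq (cs : CoxeterSystem M W) {u v : List B} (h : CommEquiv M u v) :
    cs.wordProd u = cs.wordProd v := by
  refine h.of_map_eq ?_
  rintro _ _ ⟨p, q, a, b, hab, rfl, rfl⟩
  simp only [cs.wordProd_append, cs.wordProd_cons, ← mul_assoc (cs.simple _) (cs.simple _),
    cs.simple_commute hab]

end CommEquiv

variable [DecidableEq B]

namespace CoxeterMatrix

/-- The trace of a word on the letter `s` and its neighbours: `true` for each occurrence of `s`
and `false` for each occurrence of a neighbour of `s`. -/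
def nbhd (M : CoxeterMatrix B) (s : B) (u : List B) : List Bool :=
  u.filterMap fun x => if x = s then some true else if M s x = 3 then some false else none

/-- No word commutation-equivalent to `u` contains a factor `ss`, or `sts` with `M s t = 3`. -/
def IsBraidFree (M : CoxeterMatrix B) (u : List B) : Prop :=
  ∀ s, ¬ [true, true] <:+: M.nbhd s u ∧ ¬ [true, false, true] <:+: M.nbhd s u

theorem nbhd_append (s : B) (u v : List B) : M.nbhd s (u ++ v) = M.nbhd s u ++ M.nbhd s v :=
  List.filterMap_append

theorem nbhd_cons_self (s : B) (u : List B) : M.nbhd s (s :: u) = true :: M.nbhd s u := by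
  simp [nbhd]

theorem nbhd_cons_of_adj {s t : B} (h : M s t = 3) (u : List B) :
    M.nbhd s (t :: u) = false :: M.nbhd s u := by
  have : t ≠ s := by rintro rfl; simp at h
  simp [nbhd, h, this]

theorem nbhd_cons_of_commute {s t : B} (h : M s t = 2) (u : List B) :
    M.nbhd s (t :: u) = M.nbhd s u := by
  have : t ≠ s := by rintro rfl; simp at h
  simp [nbhd, h, this]

theorem nbhd_reverse (s : B) (u : List B) : M.nbhd s u.reverse = (M.nbhd s u).reverse :=
  List.filterMap_reverse

theorem nbhd_congr (hM : M.IsSimplyLaced) (s : B) {u v : List B} (h : CommEquiv M u v) :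
    M.nbhd s u = M.nbhd s v := by
  refine h.of_map_eq ?_
  rintro _ _ ⟨p, q, a, b, hab, rfl, rfl⟩
  simp only [nbhd_append]
  congr 1
  by_cases ha : a = s
  · subst ha
    simp only [nbhd_cons_self, nbhd_cons_of_commute hab]
  by_cases hb : b = s
  · subst hb
    rw [M.symmetric] at hab
    simp only [nbhd_cons_self, nbhd_cons_of_commute hab]
  rcases hM s a (Ne.symm ha) with h1 | h1 <;> rcases hM s b (Ne.symm hb) with h2 | h2 <;>
    simp [nbhd_cons_of_commute, nbhd_cons_of_adj, h1, h2]

theorem commute_of_nbhd_eq_nil (hM : M.IsSimplyLaced) {s : B} {u : List B} (h : M.nbhd s u = []) :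
    ∀ b ∈ u, M s b = 2 := by
  intro b hb
  have h1 := (List.filterMap_eq_nil_iff.1 h) b hb
  by_cases hbs : b = s
  · simp [hbs] at h1
  · rcases hM s b (Ne.symm hbs) with h2 | h2
    · exact h2
    · simp [hbs, h2] at h1

theorem exists_split_true {s : B} {u : List B} {q : List Bool} (h : M.nbhd s u = true :: q) :
    ∃ u₁ u₂, u = u₁ ++ s :: u₂ ∧ M.nbhd s u₁ = [] ∧ M.nbhd s u₂ = q := by
  obtain ⟨l₁, a, l₂, rfl, h1, h2, h3⟩ := List.filterMap_eq_cons_iff.1 h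
  have : a = s := by
    by_contra hn
    simp [hn] at h2
  subst this
  exact ⟨l₁, l₂, rfl, List.filterMap_eq_nil_iff.2 h1, h3⟩

theorem exists_split_false {s : B} {u : List B} {q : List Bool} (h : M.nbhd s u = false :: q) :
    ∃ u₁ t u₂, u = u₁ ++ t :: u₂ ∧ M s t = 3 ∧ M.nbhd s u₁ = [] ∧ M.nbhd s u₂ = q := by
  obtain ⟨l₁, a, l₂, rfl, h1, h2, h3⟩ := List.filterMap_eq_cons_iff.1 h
  refine ⟨l₁, a, l₂, rfl, ?_, List.filterMap_eq_nil_iff.2 h1, h3⟩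
  by_contra hn
  split_ifs at h2
  simp at h2

theorem commEquiv_cons_of_nbhd (hM : M.IsSimplyLaced) {s : B} {u : List B} {q : List Bool}
    (h : M.nbhd s u = true :: q) : ∃ v, CommEquiv M u (s :: v) := by
  obtain ⟨u₁, u₂, rfl, h1, -⟩ := exists_split_true h
  exact ⟨u₁ ++ u₂, (CommEquiv.cons_append_of_commute (commute_of_nbhd_eq_nil hM h1) _).symm⟩

theorem commEquiv_concat_of_nbhd (hM : M.IsSimplyLaced) {s : B} {u : List B} {p : List Bool}
    (h : M.nbhd s u = p ++ [true]) : ∃ v, CommEquiv M u (v ++ [s]) := by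
  obtain ⟨l₁, l₂, rfl, h1, h2⟩ := List.filterMap_eq_append_iff.1 h
  obtain ⟨u₁, u₂, rfl, h3, h4⟩ := exists_split_true (M := M) h2
  refine ⟨l₁ ++ u₁ ++ u₂, ?_⟩
  have := CommEquiv.cons_append_of_commute (commute_of_nbhd_eq_nil hM h4) []
  simpa using this.append_left (l₁ ++ u₁)

namespace IsBraidFree

theorem congr (hM : M.IsSimplyLaced) {u v : List B} (h : CommEquiv M u v)
    (hu : M.IsBraidFree u) : M.IsBraidFree v := fun s => by
  rw [← nbhd_congr hM s h]; exact hu s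

theorem of_infix {u v : List B} (h : u <:+: v) (hv : M.IsBraidFree v) : M.IsBraidFree u :=
  fun s => ⟨fun h' => (hv s).1 (h'.trans (h.filterMap _)),
    fun h' => (hv s).2 (h'.trans (h.filterMap _))⟩

theorem not_square {u v : List B} {s : B} : ¬ M.IsBraidFree (u ++ s :: s :: v) := fun h =>
  (h s).1 ⟨M.nbhd s u, M.nbhd s v, by simp [nbhd_append, nbhd_cons_self]⟩

theorem not_braid {u v : List B} {s t : B} (hst : M s t = 3) :
    ¬ M.IsBraidFree (u ++ s :: t :: s :: v) := fun h =>
  (h s).2 ⟨M.nbhd s u, M.nbhd s v, by simp [nbhd_append, nbhd_cons_self, nbhd_cons_of_adj hst]⟩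

end IsBraidFree

end CoxeterMatrix

namespace CoxeterSystem

open CoxeterMatrix

variable (cs : CoxeterSystem M W)

theorem isBraidFree_of_isFullyCommutative (hM : M.IsSimplyLaced) {u : List B}
    (hu : cs.IsReduced u) (hw : IsFullyCommutative cs (cs.wordProd u)) : M.IsBraidFree u := by
  refine fun s => ⟨?_, ?_⟩
  · rintro ⟨p, q, h⟩
    rw [List.append_assoc, eq_comm] at h
    obtain ⟨l₁, l₂, rfl, -, h2⟩ := List.filterMap_eq_append_iff.1 h
    obtain ⟨u₁, u₂, rfl, -, h4⟩ := exists_split_true (M := M) h2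
    obtain ⟨u₃, u₄, rfl, h5, -⟩ := exists_split_true h4
    have hc := (CommEquiv.cons_append_of_commute (commute_of_nbhd_eq_nil hM h5)
      (s :: u₄)).append_left (l₁ ++ u₁)
    rw [← List.append_assoc] at hu
    have h6 : cs.wordProd ((l₁ ++ u₁) ++ (s :: (u₃ ++ s :: u₄))) =
        cs.wordProd (l₁ ++ u₁ ++ u₃ ++ u₄) := by
      rw [hc.wordProd_eq cs]
      simp [cs.wordProd_append, cs.wordProd_cons]
    have h7 := cs.length_wordProd_le (l₁ ++ u₁ ++ u₃ ++ u₄)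
    rw [← h6, hu.eq] at h7
    simp at h7
  · rintro ⟨p, q, h⟩
    rw [List.append_assoc, eq_comm] at h
    obtain ⟨l₁, l₂, rfl, -, h2⟩ := List.filterMap_eq_append_iff.1 h
    obtain ⟨u₁, u₂, rfl, -, h4⟩ := exists_split_true (M := M) h2
    obtain ⟨u₃, t, u₄, rfl, hst, h5, h6⟩ := exists_split_false h4
    obtain ⟨u₅, u₆, rfl, h7, -⟩ := exists_split_true h6
    have hc₁ := (CommEquiv.cons_append_of_commute (commute_of_nbhd_eq_nil hM h5)
      (t :: (u₅ ++ s :: u₆))).append_left (l₁ ++ u₁)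
    have hc₂ := (CommEquiv.cons_append_of_commute (commute_of_nbhd_eq_nil hM h7)
      u₆).symm.append_left (l₁ ++ u₁ ++ u₃ ++ [s, t])
    have hprod : cs.wordProd (l₁ ++ (u₁ ++ s :: (u₃ ++ t :: (u₅ ++ s :: u₆)))) =
        cs.wordProd (l₁ ++ u₁ ++ u₃ ++ t :: s :: t :: (u₅ ++ u₆)) := by
      have e₁ := hc₁.wordProd_eq cs
      have e₂ := hc₂.wordProd_eq cs
      have e₃ := cs.simple_braid hst
      simp only [cs.wordProd_append, cs.wordProd_cons, mul_assoc, cs.wordProd_nil,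
        one_mul] at e₁ e₂ e₃ ⊢
      rw [e₁, e₂]
      simp only [← mul_assoc] at e₃ ⊢
      congr 2
      simp only [mul_assoc] at e₃ ⊢
      rw [e₃]
    have hred : cs.IsReduced (l₁ ++ u₁ ++ u₃ ++ t :: s :: t :: (u₅ ++ u₆)) := by
      unfold IsReduced
      rw [← hprod, hu.eq]
      simp
      omega
    have hperm := (hw _ _ hu rfl hred hprod.symm).perm.count_eq s
    have hts : t ≠ s := by rintro rfl; simp at hst
    simp [List.count_append, hts] at hperm
    omega

/-- The action of a simple reflection on the coordinates of a functional on the root lattice. -/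
def coordReflection (M : CoxeterMatrix B) (i : B) : Function.End (B → ℤ) := fun x b =>
  if b = i then -x i else if M i b = 3 then x b + x i else x b

theorem isLiftable_coordReflection (hM : M.IsSimplyLaced) : M.IsLiftable (coordReflection M) := by
  intro i j
  by_cases hij : i = j
  · subst hij
    rw [M.diagonal, pow_one]
    funext x b
    simp only [End.mul_apply, End.one_apply, coordReflection]
    grind
  · have hji : M j i = M i j := M.symmetric j i
    rcases hM i j hij with h | h <;> rw [h] at hji
    · rw [h, pow_two]
      funext x b
      simp only [End.mul_apply, End.one_apply, coordReflection]
      grind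
    · rw [h, pow_succ, pow_two]
      funext x b
      simp only [End.mul_apply, End.one_apply, coordReflection]
      grind

theorem simple_injective (hM : M.IsSimplyLaced) : Function.Injective cs.simple := by
  intro i j h
  by_contra hij
  have h1 := cs.lift_apply_simple (isLiftable_coordReflection hM) i
  rw [h, cs.lift_apply_simple (isLiftable_coordReflection hM) j] at h1
  have h2 := congrFun (congrFun h1 fun _ => 1) i
  simp only [coordReflection, hij] at h2
  grind

/-- If distinct `s` and `t` are right descents of `w`, then `s` is one of `w t`. -/
theorem isRightDescent_mul_simple (hM : M.IsSimplyLaced) {w : W} {s t : B} (hst : s ≠ t)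
    (hs : cs.IsRightDescent w s) (ht : cs.IsRightDescent w t) :
    cs.IsRightDescent (w * cs.simple t) s := by
  obtain ⟨τ, hτ, hτw⟩ := cs.exists_isReduced (w * cs.simple s)
  have hw : cs.wordProd (τ ++ [s]) = w := by
    rw [cs.wordProd_append, ← hτw]; simp
  rw [← hw] at ht
  obtain ⟨j, hj, hjt⟩ := cs.exchange hM _ _ ht
  rw [hw] at hjt ht
  rcases Nat.lt_or_ge j τ.length with hj' | hj'
  · rw [List.eraseIdx_append_of_lt_length hj', cs.wordProd_append] at hjt
    have h1 := cs.length_wordProd_le (τ.eraseIdx j)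
    have h2 : w * cs.simple t * cs.simple s = cs.wordProd (τ.eraseIdx j) := by
      rw [hjt]; simp [mul_assoc]
    rw [List.length_eraseIdx_of_lt hj', ← hτ.eq, ← hτw] at h1
    rw [isRightDescent_iff] at hs ht ⊢
    rw [h2]
    have := cs.length_mul_simple (w * cs.simple t) s
    rw [h2] at this
    omega
  · rw [List.eraseIdx_append_of_length_le hj', show j - τ.length = 0 by simp at hj; omega] at hjt
    simp only [List.eraseIdx_zero, List.tail_cons, List.append_nil, ← hτw] at hjt
    exact absurd (cs.simple_injective hM (mul_left_cancel hjt)).symm hst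

/-- If `s` and `t` are right descents of `w` and `M s t = 3`, then `s` is one of `w s t`. -/
theorem isRightDescent_mul_simple_mul_simple (hM : M.IsSimplyLaced) {w : W} {s t : B}
    (hst : M s t = 3) (hs : cs.IsRightDescent w s) (ht : cs.IsRightDescent w t) :
    cs.IsRightDescent (w * cs.simple s * cs.simple t) s := by
  have hne : s ≠ t := by rintro rfl; simp at hst
  have hts := cs.isRightDescent_mul_simple hM hne.symm ht hs
  obtain ⟨τ, hτ, hτw⟩ := cs.exists_isReduced (w * cs.simple s * cs.simple t)
  have hw : cs.wordProd (τ ++ [t, s]) = w := by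
    rw [cs.wordProd_append, ← hτw]; simp [cs.wordProd_cons, mul_assoc]
  have ht' := ht
  rw [← hw] at ht'
  obtain ⟨j, hj, hjt⟩ := cs.exchange hM _ _ ht'
  rw [hw] at hjt
  have hbr := cs.simple_braid hst
  rcases Nat.lt_or_ge j τ.length with hj' | hj'
  · rw [List.eraseIdx_append_of_lt_length hj', cs.wordProd_append] at hjt
    have h1 := cs.length_wordProd_le (τ.eraseIdx j)
    have h2 : w * cs.simple s * cs.simple t * cs.simple s = cs.wordProd (τ.eraseIdx j) := by
      rw [mul_assoc, mul_assoc, ← mul_assoc (cs.simple s), hbr, ← mul_assoc, ← mul_assoc, hjt]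
      simp [cs.wordProd_cons, mul_assoc]
    rw [List.length_eraseIdx_of_lt hj', ← hτ.eq, ← hτw, ← h2] at h1
    unfold IsRightDescent
    have : 0 < cs.length (w * cs.simple s * cs.simple t) := by
      rw [hτw, hτ.eq]; omega
    omega
  · rw [List.eraseIdx_append_of_length_le hj'] at hjt
    rw [← hw, cs.wordProd_append, mul_assoc] at hjt
    rw [cs.wordProd_append] at hjt
    have hjt := mul_left_cancel hjt
    have : j - τ.length = 0 ∨ j - τ.length = 1 := by simp at hj; omega
    rcases this with h | h
    · simp [h, cs.wordProd_cons] at hjt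
      rw [← hbr] at hjt
      have h3 : cs.simple s * cs.simple t = 1 := by simpa using hjt
      have := mul_eq_one_iff_eq_inv.1 h3
      rw [cs.inv_simple] at this
      exact absurd (cs.simple_injective hM this) hne
    · simp [h, cs.wordProd_cons] at hjt
      have h3 : cs.simple t * cs.simple s = 1 := by
        simpa [mul_assoc] using hjt
      have := mul_eq_one_iff_eq_inv.1 h3
      rw [cs.inv_simple] at this
      exact absurd (cs.simple_injective hM this).symm hne

theorem isReduced_and_commEquiv_of_isBraidFree (hM : M.IsSimplyLaced) (k : ℕ) :
    ∀ u : List B, u.length = k → M.IsBraidFree u → cs.IsReduced u ∧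
      ∀ v, cs.IsReduced v → cs.wordProd v = cs.wordProd u → CommEquiv M u v := by
  induction k using Nat.strong_induction_on with
  | _ k ih =>
  intro u hk hu
  rcases List.eq_nil_or_concat' u with rfl | ⟨u', s, rfl⟩
  · refine ⟨by simp [IsReduced], fun v hv hvu => ?_⟩
    have : v.length = 0 := by rw [← hv.eq, hvu]; simp
    rw [List.eq_nil_of_length_eq_zero this]
    exact CommEquiv.refl _
  have hu' : M.IsBraidFree u' := hu.of_infix (List.prefix_append _ _).isInfix
  have hlen : u'.length < k := by simp at hk; omega
  obtain ⟨hred', huniq'⟩ := ih _ hlen u' rfl hu'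
  have hred : cs.IsReduced (u' ++ [s]) := by
    by_contra hn
    have hs : cs.IsRightDescent (cs.wordProd u') s := by
      by_contra hs
      rw [not_isRightDescent_iff] at hs
      apply hn
      unfold IsReduced
      rw [cs.wordProd_append, cs.wordProd_singleton, hs, hred'.eq]; simp
    obtain ⟨τ, -, -, h1, h2⟩ := cs.exists_isReduced_concat hs
    have h3 := (huniq' _ h1 h2).append_right [s]
    exact IsBraidFree.not_square (u := τ) (v := []) (s := s) (by simpa using hu.congr hM h3)
  refine ⟨hred, fun v hv hvu => ?_⟩
  rcases List.eq_nil_or_concat' v with rfl | ⟨v', t, rfl⟩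
  · have h3 := hred.eq
    rw [← hvu] at h3
    simp at h3
  by_cases hst : t = s
  · subst hst
    refine (huniq' v' hv.of_concat ?_).append_right _
    simpa [cs.wordProd_append] using hvu
  set w := cs.wordProd (u' ++ [s]) with hw
  have hus : cs.wordProd u' = w * cs.simple s := by rw [hw, cs.wordProd_append]; simp
  have hs : cs.IsRightDescent w s := hred.isRightDescent
  have ht : cs.IsRightDescent w t := by rw [← hvu]; exact hv.isRightDescent
  have hts := cs.isRightDescent_mul_simple hM hst ht hs
  rcases hM s t (Ne.symm hst) with h | h
  · obtain ⟨τ, hτ, hτw, h1, h2⟩ := cs.exists_isReduced_concat hts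
    have h3 := huniq' _ h1 (h2.trans hus.symm)
    have h4 : CommEquiv M (u' ++ [s]) ((τ ++ [s]) ++ [t]) := by
      refine (h3.append_right [s]).trans ?_
      rw [M.symmetric] at h
      simpa using CommEquiv.swap h τ []
    have h5 : M.IsBraidFree (τ ++ [s]) :=
      (hu.congr hM h4).of_infix (List.prefix_append _ _).isInfix
    have h6 : (τ ++ [s]).length < k := by
      have := h3.perm.length_eq
      simp at this ⊢
      omega
    refine h4.trans (((ih _ h6 _ rfl h5).2 v' hv.of_concat ?_).append_right _)
    rw [cs.wordProd_append, hτw, cs.wordProd_singleton, mul_assoc, mul_assoc,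
      ← cs.simple_commute h, cs.simple_mul_simple_cancel_left, ← hvu, cs.wordProd_append]
    simp
  · exfalso
    have h7 := cs.isRightDescent_mul_simple_mul_simple hM h hs ht
    obtain ⟨τ, -, hτw, h1, h2⟩ := cs.exists_isReduced_concat h7
    have hred3 : cs.IsReduced (τ ++ [s] ++ [t]) := by
      have h8 := (cs.isRightDescent_iff).1 hts
      unfold IsReduced
      rw [cs.wordProd_append, h2]
      rw [← h2, h1.eq] at h8
      simp only [cs.wordProd_singleton, cs.simple_mul_simple_cancel_right, ← h8]
      simp
    have h3 := huniq' (τ ++ [s] ++ [t]) hred3 (by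
      rw [cs.wordProd_append, h2, hus]; simp)
    have h4 := hu.congr hM (h3.append_right [s])
    exact IsBraidFree.not_braid h (u := τ) (v := []) (by simpa using h4)

theorem isReduced_of_isBraidFree (hM : M.IsSimplyLaced) {u : List B} (hu : M.IsBraidFree u) :
    cs.IsReduced u :=
  (cs.isReduced_and_commEquiv_of_isBraidFree hM _ u rfl hu).1

theorem commEquiv_of_isBraidFree (hM : M.IsSimplyLaced) {u v : List B} (hu : M.IsBraidFree u)
    (hv : M.IsBraidFree v) (h : cs.wordProd u = cs.wordProd v) : CommEquiv M u v :=
  (cs.isReduced_and_commEquiv_of_isBraidFree hM _ u rfl hu).2 v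
    (cs.isReduced_of_isBraidFree hM hv) h.symm

theorem isFullyCommutative_iff (hM : M.IsSimplyLaced) (w : W) :
    IsFullyCommutative cs w ↔ ∃ u, M.IsBraidFree u ∧ cs.wordProd u = w := by
  constructor
  · intro hw
    obtain ⟨u, hu, rfl⟩ := cs.exists_isReduced w
    exact ⟨u, cs.isBraidFree_of_isFullyCommutative hM hu hw, rfl⟩
  · rintro ⟨u, hu, rfl⟩ v v' hv hvu hv' hvu'
    have h := (cs.isReduced_and_commEquiv_of_isBraidFree hM _ u rfl hu).2
    exact (h v hv hvu).symm.trans (h v' hv' hvu')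

end CoxeterSystem

end BraidFree

section Palindromic

variable {B W : Type*} [Group W] {M : CoxeterMatrix B} [DecidableEq B]

namespace CoxeterMatrix

/-- Words built from the empty word by wrapping in a letter, keeping the word braid-free, and by
adjoining a letter that commutes with all the others. -/
inductive IsPalindromic (M : CoxeterMatrix B) : List B → Prop
  | nil : IsPalindromic M []
  | wrap (x : B) (v : List B) : IsPalindromic M v → M.IsBraidFree (x :: (v ++ [x])) →
      IsPalindromic M (x :: (v ++ [x]))
  | central (x : B) (v : List B) : IsPalindromic M v → M.nbhd x v = [] → IsPalindromic M (x :: v)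

theorem IsBraidFree.cons_of_nbhd_eq_nil (hM : M.IsSimplyLaced) {x : B} {v : List B}
    (hv : M.IsBraidFree v) (h : M.nbhd x v = []) : M.IsBraidFree (x :: v) := by
  intro s
  by_cases hs : s = x
  · subst hs
    rw [nbhd_cons_self, h]
    decide
  rcases hM s x hs with h' | h'
  · rw [nbhd_cons_of_commute h']
    exact hv s
  · rw [nbhd_cons_of_adj h']
    constructor
    · rw [List.infix_cons_iff]
      rintro (h1 | h1)
      · simp at h1
      · exact (hv s).1 h1
    · rw [List.infix_cons_iff]
      rintro (h1 | h1)
      · simp at h1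
      · exact (hv s).2 h1

namespace IsPalindromic

theorem isBraidFree (hM : M.IsSimplyLaced) {u : List B} (hu : M.IsPalindromic u) :
    M.IsBraidFree u := by
  induction hu with
  | nil => intro s; simp [nbhd]
  | wrap x v _ h _ => exact h
  | central x v _ h ih => exact ih.cons_of_nbhd_eq_nil hM h

theorem commEquiv_reverse (hM : M.IsSimplyLaced) {u : List B} (hu : M.IsPalindromic u) :
    CommEquiv M u u.reverse := by
  induction hu with
  | nil => exact CommEquiv.refl _
  | wrap x v _ _ ih => simpa using (ih.cons x).append_right [x]
  | central x v _ h ih =>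
    have := CommEquiv.cons_append_of_commute (commute_of_nbhd_eq_nil hM h) []
    simpa using this.trans (by simpa using ih.append_right [x])

theorem wordProd_mul_self (cs : CoxeterSystem M W) (hM : M.IsSimplyLaced) {u : List B}
    (hu : M.IsPalindromic u) : cs.wordProd u * cs.wordProd u = 1 := by
  have h := (hu.commEquiv_reverse hM).wordProd_eq cs
  rw [cs.wordProd_reverse] at h
  nth_rewrite 1 [h]
  simp

end IsPalindromic

theorem nbhd_reverse_eq_self (hM : M.IsSimplyLaced) {u : List B} (h : CommEquiv M u u.reverse)
    (s : B) : (M.nbhd s u).reverse = M.nbhd s u := by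
  rw [← nbhd_reverse, ← nbhd_congr hM s h]

theorem exists_nbhd_eq (x : B) (v : List B) : ∃ q,
    M.nbhd x v = List.replicate (M.nbhd x (v.takeWhile (· ≠ x))).length false ++ q ∧
      (q = [] ∨ ∃ q', q = true :: q') := by
  have h1 : M.nbhd x (v.takeWhile (· ≠ x)) =
      List.replicate (M.nbhd x (v.takeWhile (· ≠ x))).length false := by
    rw [List.eq_replicate_iff]
    refine ⟨rfl, fun b hb => ?_⟩
    obtain ⟨a, ha, hab⟩ := List.mem_filterMap.1 hb
    have hax : a ≠ x := by simpa using List.mem_takeWhile_imp ha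
    grind
  refine ⟨M.nbhd x (v.dropWhile (· ≠ x)), ?_, ?_⟩
  · rw [← h1, ← nbhd_append, List.takeWhile_append_dropWhile]
  · rcases h : v.dropWhile (· ≠ x) with _ | ⟨y, r⟩
    · left; rfl
    · right
      have hy : y = x := by
        have := List.head_dropWhile_not (fun z => decide (z ≠ x)) (l := v) (by rw [h]; simp)
        simp only [h] at this
        exact not_not.1 (of_decide_eq_false this)
      subst hy
      exact ⟨_, nbhd_cons_self _ _⟩

theorem infix_of_infix_wrap {N p : List Bool} {N' : List Bool} (hN : N = false :: false :: N')
    (hr : N.reverse = N) (hp : p = [true, true] ∨ p = [true, false, true])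
    (h : p <:+: true :: (N ++ [true])) : p <:+: N := by
  have hpr : p.reverse = p := by rcases hp with rfl | rfl <;> rfl
  have hnp : ∀ l, ¬ p <+: true :: (N ++ l) := by
    intro l
    rcases hp with rfl | rfl <;> subst hN <;> simp [List.cons_prefix_cons]
  rcases List.infix_cons_iff.1 h with h1 | h1
  · exact absurd h1 (hnp _)
  rcases List.infix_concat_iff.1 h1 with h2 | h2
  · rw [← List.reverse_prefix, hpr] at h2
    simp only [List.reverse_append, hr, List.reverse_singleton, List.singleton_append] at h2
    exact absurd (by simpa using h2) (hnp [])
  · exact h2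

theorem infix_of_infix_wrap_false {N p : List Bool}
    (hp : p = [true, true] ∨ p = [true, false, true])
    (h : p <:+: false :: (N ++ [false])) : p <:+: N := by
  have hpr : p.reverse = p := by rcases hp with rfl | rfl <;> rfl
  have hnp : ∀ l, ¬ p <+: false :: l := by
    intro l
    rcases hp with rfl | rfl <;> simp [List.cons_prefix_cons]
  rcases List.infix_cons_iff.1 h with h1 | h1
  · exact absurd h1 (hnp _)
  rcases List.infix_concat_iff.1 h1 with h2 | h2
  · rw [← List.reverse_prefix, hpr] at h2
    simp only [List.reverse_append, List.reverse_singleton, List.singleton_append] at h2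
    exact absurd h2 (hnp _)
  · exact h2

theorem IsPalindromic.isBraidFree_wrap_iff (hM : M.IsSimplyLaced) {v : List B}
    (hv : M.IsPalindromic v) (x : B) :
    M.IsBraidFree (x :: (v ++ [x])) ↔ 2 ≤ (M.nbhd x (v.takeWhile (· ≠ x))).length := by
  obtain ⟨q, hq, hq'⟩ := exists_nbhd_eq (M := M) x v
  have hx : M.nbhd x (x :: (v ++ [x])) = true :: (M.nbhd x v ++ [true]) := by
    simp [nbhd]
  constructor
  · intro h
    by_contra! hlt
    have h1 := h x
    rw [hx, hq] at h1
    generalize (M.nbhd x (v.takeWhile (· ≠ x))).length = k at hlt h1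
    interval_cases k
    · refine h1.1 ?_
      rcases hq' with rfl | ⟨q', rfl⟩
      · exact ⟨[], [], rfl⟩
      · exact ⟨[], q' ++ [true], rfl⟩
    · refine h1.2 ?_
      rcases hq' with rfl | ⟨q', rfl⟩
      · exact ⟨[], [], rfl⟩
      · exact ⟨[], q' ++ [true], rfl⟩
  · intro h s
    have hv' := hv.isBraidFree hM
    by_cases hs : s = x
    · subst hs
      have hr := nbhd_reverse_eq_self hM (hv.commEquiv_reverse hM) s
      obtain ⟨k, hk⟩ := Nat.exists_eq_add_of_le h
      rw [hk, Nat.add_comm, List.replicate_succ, List.replicate_succ] at hq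
      rw [hx]
      exact ⟨fun h => (hv' s).1 (infix_of_infix_wrap hq hr (.inl rfl) h),
        fun h => (hv' s).2 (infix_of_infix_wrap hq hr (.inr rfl) h)⟩
    rcases hM s x hs with h' | h'
    · rw [nbhd_cons_of_commute h', nbhd_append, nbhd_cons_of_commute h']
      simpa [nbhd] using hv' s
    · rw [nbhd_cons_of_adj h', nbhd_append, nbhd_cons_of_adj h']
      exact ⟨fun h => (hv' s).1 (infix_of_infix_wrap_false (.inl rfl) h),
        fun h => (hv' s).2 (infix_of_infix_wrap_false (.inr rfl) h)⟩

/-- Peeling a left descent off a braid-free word of an involution. -/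
theorem IsBraidFree.peel (cs : CoxeterSystem M W) (hM : M.IsSimplyLaced) {u : List B}
    (hu : M.IsBraidFree u) (hw : cs.wordProd u * cs.wordProd u = 1) {x : B} {q : List Bool}
    (hx : M.nbhd x u = true :: q) :
    ∃ v, M.IsBraidFree v ∧ cs.wordProd v * cs.wordProd v = 1 ∧
      (CommEquiv M u (x :: (v ++ [x])) ∨ CommEquiv M u (x :: v) ∧ M.nbhd x v = []) := by
  obtain ⟨v, huv⟩ := commEquiv_cons_of_nbhd hM hx
  have hv := hu.congr hM huv
  rcases hN : M.nbhd x v with _ | ⟨b, N⟩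
  · refine ⟨v, hv.of_infix (List.suffix_cons _ _).isInfix, ?_, .inr ⟨huv, hN⟩⟩
    have h1 := CommEquiv.cons_append_of_commute (commute_of_nbhd_eq_nil hM hN) []
    have h2 := h1.wordProd_eq cs
    have h3 := huv.wordProd_eq cs
    rw [List.append_nil] at h2
    nth_rewrite 1 [h3.trans h2] at hw
    rw [h3, cs.wordProd_append] at hw
    simpa [mul_assoc, cs.wordProd_cons] using hw
  · have hrev : CommEquiv M u u.reverse := by
      refine cs.commEquiv_of_isBraidFree hM hu ?_ ?_
      · intro s
        have e1 : [true, true] = [true, true].reverse := rfl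
        have e2 : [true, false, true] = [true, false, true].reverse := rfl
        rw [nbhd_reverse, e1, e2, List.reverse_infix, List.reverse_infix]
        exact hu s
      · rw [cs.wordProd_reverse]
        exact mul_eq_one_iff_eq_inv.1 hw
    have h1 := nbhd_reverse_eq_self hM hrev x
    rw [nbhd_congr hM x huv, nbhd_cons_self, hN] at h1
    obtain ⟨v', hv'⟩ : ∃ v', CommEquiv M v (v' ++ [x]) := by
      refine commEquiv_concat_of_nbhd hM (p := (b :: N).dropLast) ?_
      rw [hN]
      conv_lhs => rw [← List.dropLast_append_getLast (List.cons_ne_nil b N)]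
      congr 2
      have h2 := congrArg List.head? h1
      rw [List.head?_reverse] at h2
      simp only [List.getLast?_cons_cons, List.head?_cons] at h2
      rw [List.getLast?_eq_some_getLast (List.cons_ne_nil b N)] at h2
      exact Option.some.inj h2
    have h3 := huv.trans (hv'.cons x)
    refine ⟨v', (hu.congr hM h3).of_infix ⟨[x], [x], by simp⟩, ?_, .inl h3⟩
    have h4 := h3.wordProd_eq cs
    rw [h4, cs.wordProd_cons, cs.wordProd_append, cs.wordProd_singleton] at hw
    have h5 : cs.simple x * (cs.wordProd v' * cs.wordProd v') * cs.simple x = 1 := by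
      simpa [mul_assoc] using hw
    have h6 := congrArg (fun g => cs.simple x * g * cs.simple x) h5
    simpa [mul_assoc] using h6

theorem IsBraidFree.exists_isPalindromic (cs : CoxeterSystem M W) (hM : M.IsSimplyLaced) (k : ℕ) :
    ∀ {u : List B}, u.length = k → M.IsBraidFree u → cs.wordProd u * cs.wordProd u = 1 →
      ∃ p, M.IsPalindromic p ∧ CommEquiv M u p := by
  induction k using Nat.strong_induction_on with
  | _ k ih =>
  rintro (_ | ⟨x, u⟩) hk hu hw
  · exact ⟨[], .nil, CommEquiv.refl _⟩
  obtain ⟨v, hv, hvw, h | ⟨h, hN⟩⟩ := hu.peel cs hM hw (nbhd_cons_self x u)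
  · have hl := h.perm.length_eq
    simp at hl hk
    obtain ⟨p, hp, hvp⟩ := ih v.length (by omega) rfl hv hvw
    have h1 := h.trans ((hvp.append_right [x]).cons x)
    exact ⟨_, .wrap x p hp (hu.congr hM h1), h1⟩
  · have hl := h.perm.length_eq
    simp at hl hk
    obtain ⟨p, hp, hvp⟩ := ih v.length (by omega) rfl hv hvw
    exact ⟨_, .central x p hp (by rw [← nbhd_congr hM x hvp, hN]), h.trans (hvp.cons x)⟩

end CoxeterMatrix

end Palindromic

section TypeDCounts

/-- Adjacent vertices of the chain carry the counts `2, 2` or `0, 2`. -/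
def IsZig (k l : ℕ) : Prop := l = 2 ∧ (k = 0 ∨ k = 2)

/-- The possible counts of two adjacent vertices of the chain. -/
def IsStep (k l : ℕ) : Prop := l = k + 1 ∨ k = l + 1 ∨ k = 0 ∧ l = 0 ∨ IsZig k l

/-- The possible counts at the branch vertex and at a leaf adjacent to it. -/
def IsLeafStep (k e : ℕ) : Prop :=
  k = 0 ∧ e ≤ 1 ∨ k = 1 ∧ e = 0 ∨ 1 ≤ k ∧ 2 * e = k ∨ 1 ≤ k ∧ 2 * e = k + 2 ∨ 2 * e + 2 = k

/-- The possible pairs of counts at the two leaves, when the branch vertex has count `k`. -/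
def IsLeafPair (k e f : ℕ) : Prop :=
  IsLeafStep k e ∧ IsLeafStep k f ∧
    (k ≤ 1 ∨ (2 * e = k ∨ 2 * f = k) ∧ (k = 2 ∨ e ≠ f))

/-- The letter counts of fully commutative involutions of type `D_{n+1}`. The vertex `0` is
fictitious, the vertices `1, …, n - 1` form the chain, and `n`, `n + 1` are the leaves. -/
structure IsValidCount (n : ℕ) (c : ℕ → ℕ) : Prop where
  zero : c 0 = 0
  outside : ∀ j, n + 2 ≤ j → c j = 0
  step : ∀ j, j + 1 < n → IsStep (c j) (c (j + 1))
  zig : ∀ j, j + 2 < n → IsZig (c j) (c (j + 1)) → c (j + 2) = 2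
  leaf : ∀ b, b + 1 = n → IsLeafPair (c b) (c n) (c (n + 1))
  zig_leaf : ∀ j, j + 2 = n → IsZig (c j) (c (j + 1)) → c n = 1 ∧ c (n + 1) = 1

/-- `a` is the number of leading `j`s and `b` the number of leading `j + 1`s in the restriction of
a word to the vertices `j`, `j + 1` of the chain, when these have counts `k` and `l`. -/
def IsChainLead (k l a b : ℕ) : Prop :=
  l = k + 1 ∧ a = 0 ∧ b = 1 ∨ k = l + 1 ∧ a = 1 ∧ b = 0 ∨ k = 0 ∧ l = 0 ∧ a = 0 ∧ b = 0 ∨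
    k = 0 ∧ l = 2 ∧ a = 0 ∧ b = 2 ∨ k = 2 ∧ l = 2 ∧ a = 1 ∧ b = 0

/-- `a` is the number of leading leaves and `b` the number of leading branch vertices in the
restriction of a word to the branch vertex and a leaf, when these have counts `k` and `e`. -/
def IsLeafLead (k e a b : ℕ) : Prop :=
  k = 0 ∧ e ≤ 1 ∧ a = e ∧ b = 0 ∨ k = 1 ∧ e = 0 ∧ a = 0 ∧ b = 1 ∨
    1 ≤ k ∧ 2 * e = k ∧ a = 0 ∧ b = 1 ∨ 1 ≤ k ∧ 2 * e = k + 2 ∧ a = 1 ∧ b = 0 ∨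
    2 * e + 2 = k ∧ a = 0 ∧ b = 2

/-- The leads `l s t`, the number of letters `s` before the first `t`, of a word with counts `c`. -/
structure HasLeads (n : ℕ) (c : ℕ → ℕ) (l : ℕ → ℕ → ℕ) : Prop where
  chain : ∀ j, j + 1 < n → IsChainLead (c j) (c (j + 1)) (l j (j + 1)) (l (j + 1) j)
  leaf : ∀ b, b + 1 = n → IsLeafLead (c b) (c n) (l n b) (l b n)
  leaf' : ∀ b, b + 1 = n → IsLeafLead (c b) (c (n + 1)) (l (n + 1) b) (l b (n + 1))

/-- The sum of `f` over the neighbours of `x` in the Dynkin diagram. -/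
def nbrSum (n x : ℕ) (f : ℕ → ℕ) : ℕ :=
  if x + 1 < n then f (x - 1) + f (x + 1)
  else if x + 1 = n then f (x - 1) + f n + f (n + 1) else f (n - 1)

/-- The effect on letter counts and leads of wrapping a word in the letter `x`. -/
structure IsWrap (x : ℕ) (c c' : ℕ → ℕ) (l l' : ℕ → ℕ → ℕ) : Prop where
  count_self : c' x = c x + 2
  count_of_ne : ∀ j, j ≠ x → c' j = c j
  lead_right : ∀ s, s ≠ x → l' s x = 0
  lead_left : ∀ t, t ≠ x → l' x t = if c t = 0 then c x + 2 else 1 + l x t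
  lead_of_ne : ∀ s t, s ≠ t → s ≠ x → t ≠ x → l' s t = l s t

theorem IsChainLead.of_two_le {k₀ k₁ k₂ a b a' b' : ℕ} (h₁ : IsChainLead k₀ k₁ a b)
    (h₂ : IsChainLead k₁ k₂ a' b') (hz : IsZig k₀ k₁ → k₂ = 2) (h : 2 ≤ a + b') :
    b = 0 ∧ a' = 0 ∧ (k₀ = k₁ + 1 ∧ k₂ = k₁ + 1 ∨ k₁ = 0 ∧ k₂ = 2 ∧ k₀ ≤ 1) := by
  unfold IsChainLead at h₁ h₂
  unfold IsZig at hz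
  omega

theorem IsLeafLead.of_two_le {k₀ k e f a b p q p' q' : ℕ} (h₁ : IsChainLead k₀ k a b)
    (h₂ : IsLeafLead k e p q) (h₃ : IsLeafLead k f p' q') (hp : IsLeafPair k e f)
    (hz : IsZig k₀ k → e = 1 ∧ f = 1) (h : 2 ≤ a + p + p') :
    b = 0 ∧
      (k = 0 ∧ k₀ ≤ 1 ∧ e ≤ 1 ∧ f ≤ 1 ∧ 1 ≤ e + f ∧ (k₀ = 0 → e = 1 ∧ f = 1) ∧ q = 0 ∧ q' = 0 ∨
        k₀ = k + 1 ∧ 2 ≤ k ∧ (2 * e = k + 2 ∧ 2 * f = k ∧ q = 0 ∧ q' = 1 ∨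
          2 * f = k + 2 ∧ 2 * e = k ∧ q = 1 ∧ q' = 0)) := by
  replace hp := hp.2.2
  unfold IsZig at hz
  rcases h₁ with h₁ | h₁ | h₁ | h₁ | h₁ <;> rcases h₂ with h₂ | h₂ | h₂ | h₂ | h₂ <;>
    rcases h₃ with h₃ | h₃ | h₃ | h₃ | h₃ <;> omega

theorem HasLeads.wrap_chain {n y : ℕ} {c c' : ℕ → ℕ} {l l' : ℕ → ℕ → ℕ} (hc : IsValidCount n c)
    (hl : HasLeads n c l) (hw : IsWrap (y + 1) c c' l l') (ha : y + 1 + 1 < n)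
    (h : 2 ≤ l y (y + 1) + l (y + 1 + 1) (y + 1)) :
    IsValidCount n c' ∧ HasLeads n c' l' := by
  obtain ⟨z, o, st, zg, lf, zl⟩ := hc
  obtain ⟨ch, le, le'⟩ := hl
  obtain ⟨hcx, hc', h1, h2, h3⟩ := hw
  have e0 := st y (by omega)
  have e5' := zg y ha
  obtain ⟨e1, e2, e3⟩ := (ch y (by omega)).of_two_le (ch (y + 1) (by omega)) (zg y ha) h
  clear h
  unfold IsStep IsZig at e0
  unfold IsZig at e5'
  have h2' := h2 (y + 1 + 1) (by omega)
  have h2'' := h2 y (by omega)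
  refine ⟨⟨?_, ?_, ?_, ?_, ?_, ?_⟩, ?_, ?_, ?_⟩ <;>
    try simp only [IsZig, IsStep, IsLeafPair, IsLeafStep, IsChainLead, IsLeafLead]
  · rw [hc' 0 (by omega), z]
  · intro j hj
    rw [hc' j (by omega), o j hj]
  · intro j hj
    rcases (by omega : j = y ∨ j = y + 1 ∨ (j ≠ y + 1 ∧ j + 1 ≠ y + 1)) with rfl | rfl | ⟨h, h'⟩
    · rw [hc' j (by omega), hcx]
      omega
    · rw [hc' (y + 1 + 1) (by omega), hcx]
      omega
    · rw [hc' _ h, hc' _ h']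
      exact st j hj
  · intro j hj
    have e6 := zg j hj
    unfold IsZig at e6
    rcases (by omega : j + 1 = y ∨ j = y ∨ j = y + 1 ∨
      (j ≠ y + 1 ∧ j + 1 ≠ y + 1 ∧ j + 2 ≠ y + 1)) with rfl | rfl | rfl | ⟨h, h', h''⟩
    · rw [hc' j (by omega), hc' (j + 1) (by omega), hcx]
      have e5 : c (j + 2) = c (j + 1 + 1) := rfl
      omega
    · rw [hc' j (by omega), hc' (j + 2) (by omega), hcx]
      have e5 : c (j + 2) = c (j + 1 + 1) := rfl
      omega
    · rw [hc' (y + 1 + 1) (by omega), hc' (y + 1 + 2) (by omega), hcx]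
      have e4 : c (y + 2) = c (y + 1 + 1) := rfl
      omega
    · rw [hc' _ h, hc' _ h', hc' _ h'']
      exact e6
  · intro b hb
    rw [hc' b (by omega), hc' n (by omega), hc' (n + 1) (by omega)]
    exact lf b hb
  · intro j hj
    have e6 := zl j hj
    unfold IsZig at e6
    rw [hc' n (by omega), hc' (n + 1) (by omega)]
    rcases (by omega : j = y + 1 ∨ (j ≠ y + 1 ∧ j + 1 ≠ y + 1)) with rfl | ⟨h, h'⟩
    · rw [hcx, hc' (y + 1 + 1) (by omega)]
      omega
    · rw [hc' _ h, hc' _ h']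
      exact e6
  · intro j hj
    rcases (by omega : j = y ∨ j = y + 1 ∨ (j ≠ y + 1 ∧ j + 1 ≠ y + 1)) with rfl | rfl | ⟨h, h'⟩
    · rw [hc' j (by omega), hcx, h1 j (by omega), h2'']
      split_ifs <;> omega
    · rw [hc' (y + 1 + 1) (by omega), hcx, h1 (y + 1 + 1) (by omega), h2']
      split_ifs <;> omega
    · rw [hc' _ h, hc' _ h', h3 _ _ (by omega) h h', h3 _ _ (by omega) h' h]
      exact ch j hj
  · intro b hb
    rw [hc' b (by omega), hc' n (by omega), h3 _ _ (by omega) (by omega) (by omega),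
      h3 _ _ (by omega) (by omega) (by omega)]
    exact le b hb
  · intro b hb
    rw [hc' b (by omega), hc' (n + 1) (by omega), h3 _ _ (by omega) (by omega) (by omega),
      h3 _ _ (by omega) (by omega) (by omega)]
    exact le' b hb

theorem HasLeads.wrap_branch {n y : ℕ} {c c' : ℕ → ℕ} {l l' : ℕ → ℕ → ℕ} (hc : IsValidCount n c)
    (hl : HasLeads n c l) (hw : IsWrap (y + 1) c c' l l') (hb : y + 1 + 1 = n)
    (h : 2 ≤ l y (y + 1) + l n (y + 1) + l (n + 1) (y + 1)) :
    IsValidCount n c' ∧ HasLeads n c' l' := by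
  obtain ⟨z, o, st, zg, lf, zl⟩ := hc
  obtain ⟨ch, le, le'⟩ := hl
  obtain ⟨hcx, hc', h1, h2, h3⟩ := hw
  obtain ⟨e1, e3⟩ := IsLeafLead.of_two_le (ch y (by omega)) (le _ hb) (le' _ hb)
    (lf _ hb) (zl y hb) h
  clear h
  have e4 := zl y hb
  unfold IsZig at e4
  have h20 := h2 y (by omega)
  have h21 := h2 n (by omega)
  have h22 := h2 (n + 1) (by omega)
  refine ⟨⟨?_, ?_, ?_, ?_, ?_, ?_⟩, ?_, ?_, ?_⟩ <;>
    try simp only [IsZig, IsStep, IsLeafPair, IsLeafStep, IsChainLead, IsLeafLead]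
  · rw [hc' 0 (by omega), z]
  · intro j hj
    rw [hc' j (by omega), o j hj]
  · intro j hj
    rcases (by omega : j = y ∨ (j ≠ y + 1 ∧ j + 1 ≠ y + 1)) with rfl | ⟨h, h'⟩
    · rw [hc' j (by omega), hcx]
      omega
    · rw [hc' _ h, hc' _ h']
      exact st j hj
  · intro j hj
    have e6 := zg j hj
    unfold IsZig at e6
    rcases (by omega : j + 1 = y ∨
      (j ≠ y + 1 ∧ j + 1 ≠ y + 1 ∧ j + 2 ≠ y + 1)) with rfl | ⟨h, h', h''⟩
    · rw [hc' j (by omega), hc' (j + 1) (by omega), hcx]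
      have e4 : c (j + 2) = c (j + 1 + 1) := rfl
      omega
    · rw [hc' _ h, hc' _ h', hc' _ h'']
      exact e6
  · intro b hb
    obtain rfl : b = y + 1 := by omega
    rw [hcx, hc' n (by omega), hc' (n + 1) (by omega)]
    omega
  · intro j hj
    obtain rfl : j = y := by omega
    rw [hc' n (by omega), hc' (n + 1) (by omega), hc' j (by omega), hcx]
    omega
  · intro j hj
    rcases (by omega : j = y ∨ (j ≠ y + 1 ∧ j + 1 ≠ y + 1)) with rfl | ⟨h, h'⟩
    · rw [hc' j (by omega), hcx, h1 j (by omega), h20]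
      split_ifs <;> omega
    · rw [hc' _ h, hc' _ h', h3 _ _ (by omega) h h', h3 _ _ (by omega) h' h]
      exact ch j hj
  · intro b hb
    obtain rfl : b = y + 1 := by omega
    rw [hcx, hc' n (by omega), h1 _ (by omega), h21]
    split_ifs <;> omega
  · intro b hb
    obtain rfl : b = y + 1 := by omega
    rw [hcx, hc' (n + 1) (by omega), h1 _ (by omega), h22]
    split_ifs <;> omega

theorem HasLeads.wrap_leaf {b x : ℕ} {c c' : ℕ → ℕ} {l l' : ℕ → ℕ → ℕ} (hc : IsValidCount (b + 1) c)
    (hl : HasLeads (b + 1) c l) (hw : IsWrap x c c' l l') (hxb : x = b + 1 ∨ x = b + 1 + 1)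
    (h : 2 ≤ l b x) :
    IsValidCount (b + 1) c' ∧ HasLeads (b + 1) c' l' := by
  obtain ⟨z, o, st, zg, lf, zl⟩ := hc
  obtain ⟨ch, le, le'⟩ := hl
  obtain ⟨hcx, hc', h1, h2, h3⟩ := hw
  have e2 := le b rfl
  have e2' := le' b rfl
  have e3 : c b = 2 ∧ c (b + 1) + c (b + 1 + 1) = 1 ∧ c x = 0 ∨
      4 ≤ c b ∧ 2 * c x + 2 = c b ∧ (x = b + 1 ∧ 2 * c (b + 1 + 1) = c b ∨
        x = b + 1 + 1 ∧ 2 * c (b + 1) = c b) := by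
    have := (lf b rfl).2.2
    unfold IsLeafLead at e2 e2'
    rcases hxb with rfl | rfl <;> omega
  have e4 : l b x = 2 ∧ l x b = 0 := by
    unfold IsLeafLead at e2 e2'
    rcases hxb with rfl | rfl <;> omega
  clear h
  have h20 := h2 b (by omega)
  have hcb : ∀ j, j ≤ b → c' j = c j := fun j hj => hc' j (by omega)
  refine ⟨⟨?_, ?_, ?_, ?_, ?_, ?_⟩, ?_, ?_, ?_⟩ <;>
    try simp only [IsZig, IsStep, IsLeafPair, IsLeafStep, IsChainLead, IsLeafLead]
  · rw [hc' 0 (by omega), z]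
  · intro j hj
    rw [hc' j (by omega), o j hj]
  · intro j hj
    rw [hcb _ (by omega), hcb _ (by omega)]
    exact st j hj
  · intro j hj
    rw [hcb _ (by omega), hcb _ (by omega), hcb _ (by omega)]
    exact zg j hj
  · intro b' hb
    obtain rfl : b' = b := by omega
    rw [hcb _ le_rfl]
    rcases hxb with rfl | rfl <;> rw [hcx, hc' _ (by omega)] <;> omega
  · intro j hj
    have e6 := zl j hj
    unfold IsZig at e6
    obtain rfl : b = j + 1 := by omega
    rw [hcb _ (by omega), hcb _ (by omega)]
    rcases hxb with rfl | rfl <;> rw [hcx, hc' _ (by omega)] <;> omega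
  · intro j hj
    rw [hcb _ (by omega), hcb _ (by omega), h3 _ _ (by omega) (by omega) (by omega),
      h3 _ _ (by omega) (by omega) (by omega)]
    exact ch j hj
  · intro b' hb
    obtain rfl : b' = b := by omega
    rw [hcb _ le_rfl]
    rcases hxb with rfl | rfl
    · rw [hcx, h1 _ (by omega), h20]
      split_ifs <;> omega
    · rw [hc' _ (by omega), h3 _ _ (by omega) (by omega) (by omega),
      h3 _ _ (by omega) (by omega) (by omega)]
      exact e2
  · intro b' hb
    obtain rfl : b' = b := by omega
    rw [hcb _ le_rfl]
    rcases hxb with rfl | rfl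
    · rw [hc' _ (by omega), h3 _ _ (by omega) (by omega) (by omega),
      h3 _ _ (by omega) (by omega) (by omega)]
      exact e2'
    · rw [hcx, h1 _ (by omega), h20]
      split_ifs <;> omega

theorem HasLeads.wrap {n x : ℕ} {c c' : ℕ → ℕ} {l l' : ℕ → ℕ → ℕ} (hn : 1 ≤ n) (hx : 1 ≤ x)
    (hx' : x ≤ n + 1) (hc : IsValidCount n c) (hl : HasLeads n c l) (hw : IsWrap x c c' l l')
    (h : 2 ≤ nbrSum n x (fun s => l s x)) : IsValidCount n c' ∧ HasLeads n c' l' := by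
  obtain ⟨y, rfl⟩ : ∃ y, x = y + 1 := ⟨x - 1, by omega⟩
  unfold nbrSum at h
  split_ifs at h with h₁ h₂
  · exact hl.wrap_chain hc hw h₁ h
  · exact hl.wrap_branch hc hw h₂ h
  · obtain ⟨b, rfl⟩ : ∃ b, n = b + 1 := ⟨n - 1, by omega⟩
    exact hl.wrap_leaf hc hw (by omega) h

/-- The effect on letter counts and leads of adding a letter `x` to a word commuting with `x`. -/
structure IsCentral (x : ℕ) (c c' : ℕ → ℕ) (l l' : ℕ → ℕ → ℕ) : Prop where
  count_self : c' x = 1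
  count_of_ne : ∀ j, j ≠ x → c' j = c j
  lead_right : ∀ s, s ≠ x → l' s x = 0
  lead_left : ∀ t, t ≠ x → l' x t = 1 + l x t
  lead_of_ne : ∀ s t, s ≠ t → s ≠ x → t ≠ x → l' s t = l s t

theorem nbrSum_eq_zero {n x : ℕ} {c : ℕ → ℕ} (hx : 1 ≤ x) (hx' : x ≤ n + 1)
    (h : nbrSum n x c = 0) : (∀ j, j + 1 < n → (j = x → c (j + 1) = 0) ∧ (j + 1 = x → c j = 0)) ∧
      ∀ b, b + 1 = n → (b = x → c n = 0 ∧ c (n + 1) = 0) ∧ (n = x → c b = 0) ∧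
        (n + 1 = x → c b = 0) := by
  unfold nbrSum at h
  refine ⟨fun j hj => ⟨?_, ?_⟩, fun b hb => ⟨?_, ?_, ?_⟩⟩ <;> intro he <;> subst he
  · split_ifs at h
    omega
  · split_ifs at h <;> first | omega | simp_all
  · split_ifs at h <;> omega
  · split_ifs at h <;> first | omega | skip
    obtain rfl : b = n - 1 := by omega
    exact h
  · split_ifs at h <;> first | omega | skip
    obtain rfl : b = n - 1 := by omega
    exact h

theorem IsValidCount.central {n x : ℕ} {c c' : ℕ → ℕ} (hx : 1 ≤ x)
    (hx' : x ≤ n + 1) (hc : IsValidCount n c) (hcx : c' x = 1) (hc' : ∀ j, j ≠ x → c' j = c j)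
    (h : nbrSum n x c = 0) : IsValidCount n c' := by
  obtain ⟨z, o, st, zg, lf, zl⟩ := hc
  obtain ⟨hch, hlf⟩ := nbrSum_eq_zero hx hx' h
  refine ⟨?_, ?_, ?_, ?_, ?_, ?_⟩
  · rw [hc' 0 (by omega), z]
  · intro j hj
    rw [hc' j (by omega), o j hj]
  · intro j hj
    have e := hch j hj
    rcases (by omega : j = x ∨ j + 1 = x ∨ (j ≠ x ∧ j + 1 ≠ x)) with h | h | ⟨h, h'⟩
    · rw [hc' (j + 1) (by omega), e.1 h, h, hcx]
      simp [IsStep]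
    · rw [hc' j (by omega), e.2 h, h, hcx]
      simp [IsStep]
    · rw [hc' _ h, hc' _ h']
      exact st j hj
  · intro j hj
    have e := hch (j + 1) hj
    have e6 := zg j hj
    unfold IsZig at e6 ⊢
    rcases (by omega : j = x ∨ j + 1 = x ∨ j + 2 = x ∨ (j ≠ x ∧ j + 1 ≠ x ∧ j + 2 ≠ x)) with
      h | h | h | ⟨h, h', h''⟩
    · rw [h, hcx]
      omega
    · rw [h, hcx]
      omega
    · rw [hc' (j + 1) (by omega), e.2 h]
      omega
    · rw [hc' _ h, hc' _ h', hc' _ h'']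
      exact e6
  · intro b hb
    have e := hlf b hb
    have e5 := lf b hb
    rcases (by omega : b = x ∨ n = x ∨ n + 1 = x ∨ (b ≠ x ∧ n ≠ x ∧ n + 1 ≠ x)) with
      h | h | h | ⟨h, h', h''⟩
    · rw [hc' n (by omega), hc' (n + 1) (by omega), (e.1 h).1, (e.1 h).2, h, hcx]
      simp [IsLeafPair, IsLeafStep]
    · rw [hc' b (by omega), hc' (n + 1) (by omega), h, hcx]
      rw [e.2.1 h] at e5 ⊢
      refine ⟨?_, h ▸ e5.2.1, by omega⟩
      simp [IsLeafStep]
    · rw [hc' b (by omega), hc' n (by omega), h, hcx]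
      rw [e.2.2 h] at e5 ⊢
      refine ⟨e5.1, ?_, by omega⟩
      simp [IsLeafStep]
    · rw [hc' _ h, hc' _ h', hc' _ h'']
      exact e5
  · intro j hj
    have e := hlf (j + 1) (by omega)
    have e6 := zl j hj
    unfold IsZig at e6 ⊢
    rcases (by omega : j = x ∨ j + 1 = x ∨ n = x ∨ n + 1 = x ∨
      (j ≠ x ∧ j + 1 ≠ x ∧ n ≠ x ∧ n + 1 ≠ x)) with h | h | h | h | ⟨h, h', h'', h'''⟩
    · have := hch j (by omega)
      rw [hc' (j + 1) (by omega)]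
      omega
    · rw [h, hcx]
      omega
    · rw [hc' (j + 1) (by omega)]
      omega
    · rw [hc' (j + 1) (by omega)]
      omega
    · rw [hc' _ h, hc' _ h', hc' _ h'', hc' _ h''']
      exact e6

theorem HasLeads.central {n x : ℕ} {c c' : ℕ → ℕ} {l l' : ℕ → ℕ → ℕ} (hx : 1 ≤ x)
    (hx' : x ≤ n + 1) (hc : IsValidCount n c) (hl : HasLeads n c l) (hw : IsCentral x c c' l l')
    (h₀ : c x = 0) (h : nbrSum n x c = 0) : IsValidCount n c' ∧ HasLeads n c' l' := by
  obtain ⟨ch, le, le'⟩ := hl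
  obtain ⟨hcx, hc', h1, h2, h3⟩ := hw
  refine ⟨hc.central hx hx' hcx hc' h, ?_⟩
  obtain ⟨hch, hlf⟩ := nbrSum_eq_zero hx hx' h
  clear hc
  refine ⟨?_, ?_, ?_⟩
  · intro j hj
    have e := hch j hj
    have e6 := ch j hj
    rcases (by omega : j = x ∨ j + 1 = x ∨ (j ≠ x ∧ j + 1 ≠ x)) with h | h | ⟨h, h'⟩
    · rw [hc' (j + 1) (by omega), h, hcx, h1 _ (by omega), h2 _ (by omega)]
      unfold IsChainLead at e6 ⊢
      subst h
      omega
    · rw [hc' j (by omega), h, hcx, h1 _ (by omega), h2 _ (by omega)]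
      unfold IsChainLead at e6 ⊢
      subst h
      omega
    · rw [hc' _ h, hc' _ h', h3 _ _ (by omega) h h', h3 _ _ (by omega) h' h]
      exact e6
  · intro b hb
    have e := hlf b hb
    have e5 := le b hb
    rcases (by omega : b = x ∨ n = x ∨ (b ≠ x ∧ n ≠ x)) with h | h | ⟨h, h'⟩
    · rw [hc' n (by omega), h, hcx, h1 _ (by omega), h2 _ (by omega)]
      unfold IsLeafLead at e5 ⊢
      subst h
      omega
    · rw [hc' b (by omega), h, hcx, h1 _ (by omega), h2 _ (by omega)]
      unfold IsLeafLead at e5 ⊢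
      subst h
      omega
    · rw [hc' _ h, hc' _ h', h3 _ _ (by omega) h h', h3 _ _ (by omega) h' h]
      exact e5
  · intro b hb
    have e := hlf b hb
    have e5 := le' b hb
    rcases (by omega : b = x ∨ n + 1 = x ∨ (b ≠ x ∧ n + 1 ≠ x)) with h | h | ⟨h, h'⟩
    · rw [hc' (n + 1) (by omega), h, hcx, h1 _ (by omega), h2 _ (by omega)]
      unfold IsLeafLead at e5 ⊢
      subst h
      omega
    · rw [hc' b (by omega), h, hcx, h1 _ (by omega), h2 _ (by omega)]
      unfold IsLeafLead at e5 ⊢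
      subst h
      omega
    · rw [hc' _ h, hc' _ h', h3 _ _ (by omega) h h', h3 _ _ (by omega) h' h]
      exact e5

theorem IsValidCount.of_add_le_one {n : ℕ} {c : ℕ → ℕ} (z : c 0 = 0)
    (o : ∀ j, n + 2 ≤ j → c j = 0) (h : ∀ j, j + 1 < n → c j + c (j + 1) ≤ 1)
    (h' : ∀ b, b + 1 = n → c b + c n ≤ 1 ∧ c b + c (n + 1) ≤ 1) : IsValidCount n c := by
  refine ⟨z, o, fun j hj => ?_, fun j hj => ?_, fun b hb => ?_, fun j hj => ?_⟩
  · have := h j hj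
    unfold IsStep
    omega
  · have := h j (by omega)
    unfold IsZig
    omega
  · have := h' b hb
    unfold IsLeafPair IsLeafStep
    omega
  · have := h j (by omega)
    unfold IsZig
    omega

theorem IsValidCount.add_le_one {n : ℕ} {c : ℕ → ℕ} (hc : IsValidCount n c)
    (h : ∀ j, j < n → c j ≤ 1) : (∀ j, j + 1 < n → c j + c (j + 1) ≤ 1) ∧
      ∀ b, b + 1 = n → c b + c n ≤ 1 ∧ c b + c (n + 1) ≤ 1 := by
  refine ⟨fun j hj => ?_, fun b hb => ?_⟩
  · have h₁ := hc.step j hj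
    have h₂ := h j (by omega)
    have h₃ := h (j + 1) hj
    unfold IsStep IsZig at h₁
    omega
  · have h₁ := hc.leaf b hb
    have h₂ := h b (by omega)
    unfold IsLeafPair IsLeafStep at h₁
    omega

theorem IsValidCount.unwrap_chain {n y : ℕ} {c c' : ℕ → ℕ} (hc : IsValidCount n c)
    (hn : y + 1 + 1 < n) (hx : c (y + 1) = c' (y + 1) + 2) (hc' : ∀ j, j ≠ y + 1 → c' j = c j)
    (hl : c y < c (y + 1)) (hr : c (y + 1 + 1) ≤ c (y + 1)) :
    IsValidCount n c' ∧ ∀ l, HasLeads n c' l → 2 ≤ nbrSum n (y + 1) (fun s => l s (y + 1)) := by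
  obtain ⟨z, o, st, zg, lf, zl⟩ := hc
  have e1 := st y (by omega)
  have e2 := st (y + 1) (by omega)
  have e3 := zg y (by omega)
  have e0 : c (y + 2) = c (y + 1 + 1) := rfl
  have e4 : c y = c' (y + 1) + 1 ∧ c (y + 1 + 1) = c' (y + 1) + 1 ∨
      c y ≤ 1 ∧ c' (y + 1) = 0 ∧ c (y + 1 + 1) = 2 := by
    unfold IsStep IsZig at e1 e2
    unfold IsZig at e3
    omega
  clear e1 e2 e3
  refine ⟨⟨?_, ?_, ?_, ?_, ?_, ?_⟩, ?_⟩
  · rw [hc' 0 (by omega), z]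
  · intro j hj
    rw [hc' j (by omega), o j hj]
  · intro j hj
    rcases (by omega : j = y ∨ j = y + 1 ∨ (j ≠ y + 1 ∧ j + 1 ≠ y + 1)) with rfl | rfl | ⟨h, h'⟩
    · rw [hc' j (by omega)]
      unfold IsStep IsZig
      omega
    · rw [hc' (y + 1 + 1) (by omega)]
      unfold IsStep IsZig
      omega
    · rw [hc' _ h, hc' _ h']
      exact st j hj
  · intro j hj
    have e6 := zg j hj
    unfold IsZig at e6 ⊢
    rcases (by omega : j + 1 = y ∨ j = y ∨ j = y + 1 ∨
      (j ≠ y + 1 ∧ j + 1 ≠ y + 1 ∧ j + 2 ≠ y + 1)) with rfl | rfl | rfl | ⟨h, h', h''⟩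
    · rw [hc' j (by omega), hc' (j + 1) (by omega)]
      have e5 : c (j + 2) = c (j + 1 + 1) := rfl
      omega
    · rw [hc' j (by omega), hc' (j + 2) (by omega)]
      omega
    · rw [hc' (y + 1 + 1) (by omega), hc' (y + 1 + 2) (by omega)]
      omega
    · rw [hc' _ h, hc' _ h', hc' _ h'']
      exact e6
  · intro b hb
    rw [hc' b (by omega), hc' n (by omega), hc' (n + 1) (by omega)]
    exact lf b hb
  · intro j hj
    have e6 := zl j hj
    unfold IsZig at e6 ⊢
    rw [hc' n (by omega), hc' (n + 1) (by omega)]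
    rcases (by omega : j = y + 1 ∨ (j ≠ y + 1 ∧ j + 1 ≠ y + 1)) with rfl | ⟨h, h'⟩
    · rw [hc' (y + 1 + 1) (by omega)]
      omega
    · rw [hc' _ h, hc' _ h']
      exact e6
  · intro l hl
    have e5 := hl.chain y (by omega)
    have e6 := hl.chain (y + 1) (by omega)
    rw [hc' y (by omega)] at e5
    rw [hc' (y + 1 + 1) (by omega)] at e6
    rw [nbrSum, if_pos hn]
    unfold IsChainLead at e5 e6
    simp only [Nat.add_sub_cancel]
    omega

theorem IsValidCount.unwrap_branch {n y : ℕ} {c c' : ℕ → ℕ} (hc : IsValidCount n c)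
    (hn : y + 1 + 1 = n) (hx : c (y + 1) = c' (y + 1) + 2) (hc' : ∀ j, j ≠ y + 1 → c' j = c j)
    (hl : c y < c (y + 1)) (hr : 2 * c n ≠ c (y + 1) + 2) (hr' : 2 * c (n + 1) ≠ c (y + 1) + 2) :
    IsValidCount n c' ∧ ∀ l, HasLeads n c' l → 2 ≤ nbrSum n (y + 1) (fun s => l s (y + 1)) := by
  obtain ⟨z, o, st, zg, lf, zl⟩ := hc
  have e1 := st y (by omega)
  have e2 := lf (y + 1) (by omega)
  have e3 := zl y (by omega)
  have e4 : c y = c' (y + 1) + 1 ∧ 1 ≤ c' (y + 1) ∧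
        (2 * c n = c' (y + 1) + 2 ∧ 2 * c (n + 1) = c' (y + 1) ∨
          2 * c (n + 1) = c' (y + 1) + 2 ∧ 2 * c n = c' (y + 1)) ∨
      c y ≤ 1 ∧ c' (y + 1) = 0 ∧ c n ≤ 1 ∧ c (n + 1) ≤ 1 ∧ 2 ≤ c y + c n + c (n + 1) := by
    unfold IsStep IsZig at e1
    unfold IsLeafPair IsLeafStep at e2
    unfold IsZig at e3
    omega
  clear e1 e2 e3
  refine ⟨⟨?_, ?_, ?_, ?_, ?_, ?_⟩, ?_⟩
  · rw [hc' 0 (by omega), z]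
  · intro j hj
    rw [hc' j (by omega), o j hj]
  · intro j hj
    rcases (by omega : j = y ∨ (j ≠ y + 1 ∧ j + 1 ≠ y + 1)) with rfl | ⟨h, h'⟩
    · rw [hc' j (by omega)]
      unfold IsStep IsZig
      omega
    · rw [hc' _ h, hc' _ h']
      exact st j hj
  · intro j hj
    have e6 := zg j hj
    unfold IsZig at e6 ⊢
    rcases (by omega : j + 1 = y ∨
      (j ≠ y + 1 ∧ j + 1 ≠ y + 1 ∧ j + 2 ≠ y + 1)) with rfl | ⟨h, h', h''⟩
    · rw [hc' j (by omega), hc' (j + 1) (by omega)]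
      have e5 : c (j + 2) = c (j + 1 + 1) := rfl
      omega
    · rw [hc' _ h, hc' _ h', hc' _ h'']
      exact e6
  · intro b hb
    obtain rfl : b = y + 1 := by omega
    rw [hc' n (by omega), hc' (n + 1) (by omega)]
    unfold IsLeafPair IsLeafStep
    omega
  · intro j hj
    obtain rfl : j = y := by omega
    rw [hc' n (by omega), hc' (n + 1) (by omega), hc' j (by omega)]
    unfold IsZig
    omega
  · intro l hl
    have e5 := hl.chain y (by omega)
    have e6 := hl.leaf (y + 1) (by omega)
    have e7 := hl.leaf' (y + 1) (by omega)
    rw [hc' y (by omega)] at e5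
    rw [hc' n (by omega)] at e6
    rw [hc' (n + 1) (by omega)] at e7
    rw [nbrSum, if_neg (by omega), if_pos hn]
    simp only [Nat.add_sub_cancel]
    unfold IsChainLead at e5
    unfold IsLeafLead at e6 e7
    rcases e4 with e4 | e4 <;> omega

theorem IsValidCount.unwrap_leaf {b x : ℕ} {c c' : ℕ → ℕ} (hc : IsValidCount (b + 1) c)
    (hxb : x = b + 1 ∨ x = b + 1 + 1) (hx : c x = c' x + 2) (hc' : ∀ j, j ≠ x → c' j = c j)
    (hb : 2 ≤ c b) (hl : 2 * c x = c b + 2) :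
    IsValidCount (b + 1) c' ∧
      ∀ l, HasLeads (b + 1) c' l → 2 ≤ nbrSum (b + 1) x (fun s => l s x) := by
  obtain ⟨z, o, st, zg, lf, zl⟩ := hc
  have hcb : ∀ j, j ≤ b → c' j = c j := fun j hj => hc' j (by omega)
  have e1 := lf b rfl
  refine ⟨⟨?_, ?_, ?_, ?_, ?_, ?_⟩, ?_⟩
  · rw [hc' 0 (by omega), z]
  · intro j hj
    rw [hc' j (by omega), o j hj]
  · intro j hj
    rw [hcb _ (by omega), hcb _ (by omega)]
    exact st j hj
  · intro j hj
    rw [hcb _ (by omega), hcb _ (by omega), hcb _ (by omega)]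
    exact zg j hj
  · intro b' hb
    obtain rfl : b' = b := by omega
    rw [hcb _ le_rfl]
    unfold IsLeafPair IsLeafStep at e1 ⊢
    rcases hxb with rfl | rfl
    · rw [hc' (b' + 1 + 1) (by omega)]
      omega
    · rw [hc' (b' + 1) (by omega)]
      omega
  · intro j hj
    have e6 := zl j hj
    obtain rfl : b = j + 1 := by omega
    rw [hcb _ (by omega), hcb _ (by omega)]
    unfold IsZig at e6 ⊢
    rcases hxb with rfl | rfl <;> omega
  · intro l hl
    have e5 := hl.leaf b rfl
    have e6 := hl.leaf' b rfl
    rw [hcb _ le_rfl] at e5 e6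
    rw [nbrSum, if_neg (by omega), if_neg (by omega)]
    simp only [Nat.add_sub_cancel]
    unfold IsLeafLead at e5 e6
    rcases hxb with rfl | rfl <;> omega

theorem IsValidCount.exists_pred {n : ℕ} {c : ℕ → ℕ} (hn : 1 ≤ n) (hc : IsValidCount n c)
    (h₀ : ∃ x, c x ≠ 0) : ∃ x c', 1 ≤ x ∧ x ≤ n + 1 ∧ (∀ j, j ≠ x → c' j = c j) ∧
      IsValidCount n c' ∧ (c x = 1 ∧ c' x = 0 ∧ nbrSum n x c' = 0 ∨
        c x = c' x + 2 ∧ ∀ l, HasLeads n c' l → 2 ≤ nbrSum n x (fun s => l s x)) := by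
  classical
  have key : ∀ x k, c x = k + 2 → (∀ j, j ≠ x → Function.update c x k j = c j) ∧
      c x = Function.update c x k x + 2 := fun x k hk =>
    ⟨fun j hj => Function.update_of_ne hj _ _, by rw [Function.update_self, hk]⟩
  by_cases h : ∀ j, j < n → c j ≤ 1
  · obtain ⟨x, hx⟩ := h₀
    obtain ⟨h₁, h₂⟩ := hc.add_le_one h
    have hx₁ : 1 ≤ x := Nat.one_le_iff_ne_zero.mpr fun h => hx (h ▸ hc.zero)
    have hx₂ : x ≤ n + 1 := by
      by_contra h
      exact hx (hc.outside x (by omega))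
    have hle : ∀ j, Function.update c x 0 j ≤ c j := fun j => by
      by_cases hj : j = x
      · subst hj
        simp
      · rw [Function.update_of_ne hj]
    refine ⟨x, Function.update c x 0, hx₁, hx₂, fun j hj => Function.update_of_ne hj _ _,
      .of_add_le_one ?_ ?_ ?_ ?_, .inl ⟨?_, Function.update_self .., ?_⟩⟩
    · exact Nat.le_zero.mp ((hle 0).trans hc.zero.le)
    · exact fun j hj => Nat.le_zero.mp ((hle j).trans (hc.outside j hj).le)
    · exact fun j hj => (Nat.add_le_add (hle j) (hle (j + 1))).trans (h₁ j hj)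
    · exact fun b hb => ⟨(Nat.add_le_add (hle b) (hle n)).trans (h₂ b hb).1,
        (Nat.add_le_add (hle b) (hle (n + 1))).trans (h₂ b hb).2⟩
    · have h₃ := h₂ (n - 1) (by omega)
      rcases (by omega : x < n ∨ x = n ∨ x = n + 1) with h | rfl | rfl
      · have := h₁ (x - 1)
        rw [Nat.sub_add_cancel hx₁] at this
        have := this h
        omega
      · omega
      · omega
    · refine Nat.le_zero.mp (le_trans (b := nbrSum n x c) ?_ (Nat.le_zero.mpr ?_))
      · unfold nbrSum
        split_ifs <;> simp only [add_le_add, hle]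
      · unfold nbrSum
        have h₃ := h₁ (x - 1)
        have h₅ := h₂ (n - 1) (by omega)
        have h₆ := h₂ x
        rw [Nat.sub_add_cancel hx₁] at h₃
        split_ifs with h₇ h₈
        · have := h₁ x h₇
          omega
        · omega
        · rcases (by omega : x = n ∨ x = n + 1) with rfl | rfl <;> omega
  · push Not at h
    obtain ⟨j₀, hj₀, hj₀'⟩ := h
    obtain ⟨m, hm, hmax⟩ := Finset.exists_max_image (Finset.range n) c ⟨j₀, by simpa⟩
    have hex : ∃ i, i < n ∧ c i = c m := ⟨m, by simpa using hm, rfl⟩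
    obtain ⟨hi, hi'⟩ := Nat.find_spec hex
    have hlt : ∀ j, j < Nat.find hex → c j < c m := fun j hj =>
      lt_of_le_of_ne (hmax j (by simp; omega)) fun h =>
        Nat.find_min hex hj ⟨by omega, h⟩
    have h2 : 2 ≤ c m := hj₀'.trans_le (hmax j₀ (by simpa))
    generalize Nat.find hex = i at *
    obtain ⟨y, rfl⟩ : ∃ y, i = y + 1 := ⟨i - 1, by
      have : i ≠ 0 := fun h => by
        have := hc.zero
        subst h
        omega
      omega⟩
    have hly := hlt y (by omega)
    obtain ⟨k, hk⟩ : ∃ k, c (y + 1) = k + 2 := ⟨c (y + 1) - 2, by omega⟩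
    obtain ⟨hu, hu'⟩ := key _ _ hk
    by_cases hb : y + 1 + 1 = n
    · by_cases he : ∃ x, (x = n ∨ x = n + 1) ∧ 2 * c x = c (y + 1) + 2
      · obtain ⟨x, hx, he⟩ := he
        obtain ⟨k', hk'⟩ : ∃ k, c x = k + 2 := ⟨c x - 2, by omega⟩
        obtain ⟨hu, hu'⟩ := key _ _ hk'
        subst hb
        obtain ⟨h₁, h₂⟩ := hc.unwrap_leaf hx hu' hu (by omega) he
        exact ⟨x, _, by omega, by omega, hu, h₁, .inr ⟨hu', h₂⟩⟩
      · push Not at he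
        obtain ⟨h₁, h₂⟩ := hc.unwrap_branch hb hu' hu (by omega) (he _ (.inl rfl)) (he _ (.inr rfl))
        exact ⟨y + 1, _, by omega, by omega, hu, h₁, .inr ⟨hu', h₂⟩⟩
    · have := hmax (y + 1 + 1) (by simp; omega)
      obtain ⟨h₁, h₂⟩ := hc.unwrap_chain (by omega) hu' hu (by omega) (by omega)
      exact ⟨y + 1, _, by omega, by omega, hu, h₁, .inr ⟨hu', h₂⟩⟩

end TypeDCounts

section TypeDWords

/-- The number of letters `s` before the first `t` in the word `u`. -/
def leads (u : List ℕ) (s t : ℕ) : ℕ := (u.takeWhile (· ≠ t)).count s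

theorem takeWhile_ne_concat {s x : ℕ} (h : s ≠ x) (v : List ℕ) :
    (v ++ [x]).takeWhile (· ≠ s) = if s ∈ v then v.takeWhile (· ≠ s) else v ++ [x] := by
  induction v with
  | nil => simp [h.symm]
  | cons a v ih =>
    by_cases ha : a = s
    · subst ha
      simp
    · rw [List.cons_append, List.takeWhile_cons_of_pos (by simpa), ih,
        List.takeWhile_cons_of_pos (by simpa)]
      simp only [List.mem_cons, Ne.symm ha, false_or]
      split_ifs <;> rfl

theorem takeWhile_ne_of_notMem {s : ℕ} {v : List ℕ} (h : s ∉ v) : v.takeWhile (· ≠ s) = v := by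
  rw [List.takeWhile_eq_self_iff]
  rintro a ha
  simp only [decide_eq_true_eq]
  exact fun h' => h (h' ▸ ha)

theorem isWrap_count_leads (x : ℕ) (v : List ℕ) :
    IsWrap x (fun j => v.count j) (fun j => (x :: (v ++ [x])).count j) (leads v)
      (leads (x :: (v ++ [x]))) where
  count_self := by simp
  count_of_ne j hj := by simp [Ne.symm hj]
  lead_right s hs := by simp [leads]
  lead_left t ht := by
    have h : t ∈ v ↔ v.count t ≠ 0 := by rw [ne_eq, List.count_eq_zero, not_not]
    rw [leads, List.takeWhile_cons_of_pos (by simpa using ht.symm), takeWhile_ne_concat ht]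
    by_cases h' : t ∈ v
    · rw [if_pos h', if_neg (h.mp h'), leads]
      simp [add_comm]
    · rw [if_neg h', if_pos (List.count_eq_zero.mpr h')]
      simp
  lead_of_ne s t hst hs ht := by
    rw [leads, List.takeWhile_cons_of_pos (by simpa using ht.symm), takeWhile_ne_concat ht]
    by_cases h' : t ∈ v
    · rw [if_pos h', leads]
      simp [Ne.symm hs]
    · rw [if_neg h', leads, takeWhile_ne_of_notMem h']
      simp [Ne.symm hs]

theorem isCentral_count_leads {x : ℕ} {v : List ℕ} (h : x ∉ v) :
    IsCentral x (fun j => v.count j) (fun j => (x :: v).count j) (leads v) (leads (x :: v)) where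
  count_self := by simp [List.count_eq_zero.mpr h]
  count_of_ne j hj := by simp [Ne.symm hj]
  lead_right s hs := by simp [leads]
  lead_left t ht := by
    rw [leads, List.takeWhile_cons_of_pos (by simpa using ht.symm), leads]
    simp [add_comm]
  lead_of_ne s t hst hs ht := by
    rw [leads, List.takeWhile_cons_of_pos (by simpa using ht.symm), leads]
    simp [Ne.symm hs]

theorem typeD_apply {n : ℕ} (i j : Fin (n + 1)) : typeD n i j =
    if (i : ℕ) = (j : ℕ) then 1
    else if ((i : ℕ) + 1 = (j : ℕ) ∧ (j : ℕ) < n) ∨ ((j : ℕ) + 1 = (i : ℕ) ∧ (i : ℕ) < n)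
        ∨ ((i : ℕ) + 2 = n ∧ (j : ℕ) = n) ∨ ((j : ℕ) + 2 = n ∧ (i : ℕ) = n) then 3
    else 2 := rfl

theorem typeD_isSimplyLaced (n : ℕ) : (typeD n).IsSimplyLaced := by
  intro i j hij
  rw [typeD_apply, if_neg (fun h => hij (Fin.ext h))]
  split_ifs <;> simp

/-- The word of vertices `1, …, n + 1` corresponding to a word in the generators. -/
def vertexWord {n : ℕ} (u : List (Fin (n + 1))) : List ℕ := u.map fun x : Fin (n + 1) => (x : ℕ) + 1

theorem count_vertexWord {n : ℕ} (u : List (Fin (n + 1))) (x : Fin (n + 1)) :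
    (vertexWord u).count ((x : ℕ) + 1) = u.count x :=
  List.count_map_of_injective _ _ (fun _ _ h => Fin.ext (Nat.succ_injective h)) x

theorem mem_vertexWord {n : ℕ} {u : List (Fin (n + 1))} {x : Fin (n + 1)} :
    (x : ℕ) + 1 ∈ vertexWord u ↔ x ∈ u := by
  simp [vertexWord, Fin.val_inj]

theorem nbrSum_count_eq_length_nbhd {n : ℕ} (x : Fin (n + 1)) {w : List (Fin (n + 1))}
    (h : x ∉ w) : nbrSum n (x + 1) (fun j => (vertexWord w).count j) =
      ((typeD n).nbhd x w).length := by
  induction w with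
  | nil => simp [nbrSum, vertexWord, CoxeterMatrix.nbhd]
  | cons a w ih =>
    obtain ⟨hxa, h⟩ := not_or.mp (List.mem_cons.not.mp h)
    have hxa' : (x : ℕ) ≠ a := fun h => hxa (Fin.ext h)
    have hx := x.isLt
    have ha := a.isLt
    have key : nbrSum n (x + 1) (fun j => (vertexWord (a :: w)).count j) =
        nbrSum n (x + 1) (fun j => (vertexWord w).count j) + if typeD n x a = 3 then 1 else 0 := by
      rw [typeD_apply, if_neg hxa']
      simp only [vertexWord, List.map_cons, List.count_cons, beq_iff_eq, nbrSum]
      split_ifs <;> omega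
    rw [key, ih h]
    rcases typeD_isSimplyLaced n x a hxa with h' | h'
    · rw [CoxeterMatrix.nbhd_cons_of_commute h', h']
      rfl
    · rw [CoxeterMatrix.nbhd_cons_of_adj h', h']
      rfl

theorem takeWhile_vertexWord {n : ℕ} (x : Fin (n + 1)) (u : List (Fin (n + 1))) :
    (vertexWord u).takeWhile (· ≠ (x : ℕ) + 1) = vertexWord (u.takeWhile (· ≠ x)) := by
  rw [vertexWord, List.takeWhile_map, vertexWord]
  congr 2
  ext a
  simp [Fin.val_inj]

theorem nbrSum_leads_eq_length_nbhd {n : ℕ} (x : Fin (n + 1)) (u : List (Fin (n + 1))) :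
    nbrSum n (x + 1) (fun s => leads (vertexWord u) s (x + 1)) =
      ((typeD n).nbhd x (u.takeWhile (· ≠ x))).length := by
  rw [← nbrSum_count_eq_length_nbhd]
  · simp only [leads, takeWhile_vertexWord]
  · intro h
    simpa using List.mem_takeWhile_imp h

theorem CoxeterMatrix.notMem_of_nbhd_eq_nil {B : Type*} [DecidableEq B] {M : CoxeterMatrix B}
    {x : B} {v : List B} (h : M.nbhd x v = []) : x ∉ v := by
  intro hx
  rw [nbhd, List.filterMap_eq_nil_iff] at h
  simpa using h x hx

namespace CoxeterMatrix

theorem IsPalindromic.isValidCount_and_hasLeads {n : ℕ} (hn : 1 ≤ n) {u : List (Fin (n + 1))}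
    (hu : (typeD n).IsPalindromic u) : IsValidCount n (fun j => (vertexWord u).count j) ∧
      HasLeads n (fun j => (vertexWord u).count j) (leads (vertexWord u)) := by
  induction hu with
  | nil =>
    refine ⟨.of_add_le_one ?_ ?_ ?_ ?_, ?_, ?_, ?_⟩ <;>
      simp [vertexWord, leads, IsChainLead, IsLeafLead]
  | wrap x v hv h ih =>
    have hw := isWrap_count_leads (x + 1) (vertexWord v)
    have e : vertexWord (x :: (v ++ [x])) = ((x : ℕ) + 1) :: (vertexWord v ++ [(x : ℕ) + 1]) := by
      simp [vertexWord]
    rw [hv.isBraidFree_wrap_iff (typeD_isSimplyLaced n) x, ← nbrSum_leads_eq_length_nbhd] at h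
    rw [e]
    exact ih.2.wrap hn (by omega) (by omega) ih.1 hw h
  | central x v hv h ih =>
    have hx := notMem_of_nbhd_eq_nil h
    have hw := isCentral_count_leads (mem_vertexWord.not.mpr hx)
    have e : vertexWord (x :: v) = ((x : ℕ) + 1) :: vertexWord v := rfl
    rw [e]
    refine ih.2.central (by omega) (by omega) ih.1 hw ?_ ?_
    · exact (count_vertexWord v x).trans (List.count_eq_zero.mpr hx)
    · rw [nbrSum_count_eq_length_nbhd x hx, h]
      rfl

end CoxeterMatrix

theorem IsValidCount.exists_isPalindromic {n : ℕ} (hn : 1 ≤ n) (k : ℕ) :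
    ∀ {c : ℕ → ℕ}, IsValidCount n c → ∑ j ∈ Finset.range (n + 2), c j = k →
      ∃ u, (typeD n).IsPalindromic u ∧ (fun j => (vertexWord u).count j) = c := by
  induction k using Nat.strong_induction_on with
  | _ k ih =>
  intro c hc hk
  by_cases h₀ : ∃ x, c x ≠ 0
  · obtain ⟨x, c', hx, hx', hne, hc', h⟩ := hc.exists_pred hn h₀
    have hlt : c' x < c x := by omega
    have hle : ∀ j, c' j ≤ c j := fun j => by
      by_cases hj : j = x
      · exact hj ▸ hlt.le
      · exact (hne j hj).le
    obtain ⟨u, hu, huc⟩ := ih _ (hk ▸ Finset.sum_lt_sum (fun j _ => hle j)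
      ⟨x, by simp; omega, hlt⟩) hc' rfl
    obtain ⟨y, rfl⟩ : ∃ y : Fin (n + 1), x = y + 1 := ⟨⟨x - 1, by omega⟩, by simp; omega⟩
    have hcnt : (vertexWord u).count ((y : ℕ) + 1) = c' (y + 1) := congrFun huc _
    rcases h with ⟨h₁, h₂, h₃⟩ | ⟨h₁, h₂⟩
    · have hy : y ∉ u := by
        rw [← List.count_eq_zero, ← count_vertexWord, hcnt, h₂]
      refine ⟨y :: u, .central y u hu ?_, ?_⟩
      · rw [← huc, nbrSum_count_eq_length_nbhd y hy] at h₃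
        exact List.length_eq_zero_iff.mp h₃
      · have hw := isCentral_count_leads (mem_vertexWord.not.mpr hy)
        ext j
        by_cases hj : j = y + 1
        · subst hj
          exact hw.count_self.trans h₁.symm
        · exact (hw.count_of_ne j hj).trans ((congrFun huc j).trans (hne j hj))
    · have hw := isWrap_count_leads (y + 1) (vertexWord u)
      have e : vertexWord (y :: (u ++ [y])) = ((y : ℕ) + 1) :: (vertexWord u ++ [(y : ℕ) + 1]) := by
        simp [vertexWord]
      refine ⟨y :: (u ++ [y]), .wrap y u hu ?_, ?_⟩
      · rw [hu.isBraidFree_wrap_iff (typeD_isSimplyLaced n), ← nbrSum_leads_eq_length_nbhd]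
        exact h₂ _ (huc ▸ (hu.isValidCount_and_hasLeads hn).2)
      · rw [e]
        ext j
        by_cases hj : j = y + 1
        · subst hj
          rw [hw.count_self, hcnt, h₁]
        · exact (hw.count_of_ne j hj).trans ((congrFun huc j).trans (hne j hj))
  · push Not at h₀
    exact ⟨[], .nil, by ext j; simp [vertexWord, h₀]⟩

theorem HasLeads.nbrSum_eq {n x : ℕ} {c : ℕ → ℕ} {l l' : ℕ → ℕ → ℕ} (hx : 1 ≤ x)
    (hx' : x ≤ n + 1) (hn : 1 ≤ n) (h : HasLeads n c l)
    (h' : HasLeads n c l') : nbrSum n x (fun s => l s x) = nbrSum n x (fun s => l' s x) := by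
  have key₁ : ∀ j, j + 1 < n → l j (j + 1) = l' j (j + 1) ∧ l (j + 1) j = l' (j + 1) j := by
    intro j hj
    have h₁ := h.chain j hj
    have h₂ := h'.chain j hj
    unfold IsChainLead at h₁ h₂
    omega
  have key₂ : ∀ b, b + 1 = n → l n b = l' n b ∧ l b n = l' b n := by
    intro j hj
    have h₁ := h.leaf j hj
    have h₂ := h'.leaf j hj
    unfold IsLeafLead at h₁ h₂
    omega
  have key₃ : ∀ b, b + 1 = n → l (n + 1) b = l' (n + 1) b ∧ l b (n + 1) = l' b (n + 1) := by
    intro j hj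
    have h₁ := h.leaf' j hj
    have h₂ := h'.leaf' j hj
    unfold IsLeafLead at h₁ h₂
    omega
  obtain ⟨y, rfl⟩ : ∃ y, x = y + 1 := ⟨x - 1, by omega⟩
  unfold nbrSum
  split_ifs with h₁ h₂
  · have := key₁ y (by omega)
    have := key₁ (y + 1) (by omega)
    simp only [Nat.add_sub_cancel]
    omega
  · have := key₁ y (by omega)
    have := key₂ (y + 1) (by omega)
    have := key₃ (y + 1) (by omega)
    simp only [Nat.add_sub_cancel]
    omega
  · obtain ⟨b, rfl⟩ : ∃ b, n = b + 1 := ⟨n - 1, by omega⟩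
    have h₃ := key₂ b rfl
    have h₄ := key₃ b rfl
    simp only [Nat.add_sub_cancel]
    rcases (by omega : y = b ∨ y = b + 1) with rfl | rfl
    · exact h₃.2
    · exact h₄.2

namespace CoxeterMatrix

theorem IsPalindromic.nbhd_eq_true_cons {n : ℕ} (hn : 1 ≤ n) {x : Fin (n + 1)}
    {u v : List (Fin (n + 1))} (hu : (typeD n).IsPalindromic (x :: u))
    (hv : (typeD n).IsPalindromic v)
    (h : (fun j => (vertexWord (x :: u)).count j) = fun j => (vertexWord v).count j) :
    ∃ q, (typeD n).nbhd x v = true :: q := by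
  have h₁ := (hu.isValidCount_and_hasLeads hn).2
  have h₂ := (hv.isValidCount_and_hasLeads hn).2
  rw [h] at h₁
  have h₃ := h₁.nbrSum_eq (x := x + 1) (by omega) (by omega) hn h₂
  rw [nbrSum_leads_eq_length_nbhd, nbrSum_leads_eq_length_nbhd] at h₃
  simp only [ne_eq, not_true_eq_false, decide_false, Bool.false_eq_true, not_false_eq_true,
    List.takeWhile_cons_of_neg] at h₃
  have h₄ : (typeD n).nbhd x (v.takeWhile (· ≠ x)) = [] := List.length_eq_zero_iff.mp h₃.symm
  have hx : x ∈ v := by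
    rw [← List.count_pos_iff, ← count_vertexWord, ← congrFun h (x + 1), count_vertexWord]
    simp
  have h₅ : v.dropWhile (· ≠ x) ≠ [] := by
    rw [ne_eq, List.dropWhile_eq_nil_iff]
    push Not
    exact ⟨x, hx, by simp⟩
  have h₆ : (v.dropWhile (· ≠ x)).head h₅ = x := by
    simpa using List.head_dropWhile_not (· ≠ x) h₅
  rw [← List.takeWhile_append_dropWhile (p := (· ≠ x)) (l := v), nbhd_append, h₄,
    ← List.cons_head_tail h₅, h₆, nbhd_cons_self]
  exact ⟨_, rfl⟩

theorem IsPalindromic.commEquiv_of_count_eq {n : ℕ} (hn : 1 ≤ n) {u : List (Fin (n + 1))}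
    (hu : (typeD n).IsPalindromic u) : ∀ {v : List (Fin (n + 1))}, (typeD n).IsPalindromic v →
      ((fun j => (vertexWord u).count j) = fun j => (vertexWord v).count j) →
        CommEquiv (typeD n) u v := by
  have hM := typeD_isSimplyLaced n
  have hcount : ∀ {w w' : List (Fin (n + 1))},
      ((fun j => (vertexWord w).count j) = fun j => (vertexWord w').count j) ↔
        ∀ x, w.count x = w'.count x := by
    refine fun {w w'} => ⟨fun h x => ?_, fun h => ?_⟩
    · rw [← count_vertexWord, ← count_vertexWord]
      exact congrFun h _
    · ext j
      exact ((List.perm_iff_count.mpr h).map _).count_eq j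
  induction hu with
  | nil =>
    intro v _ h
    obtain rfl : v = [] := by
      refine List.eq_nil_iff_forall_not_mem.mpr fun x hx => ?_
      rw [← List.count_pos_iff, ← hcount.mp h x] at hx
      simp at hx
    exact .refl _
  | wrap x u hu hbf ih =>
    intro v hv h
    obtain ⟨q, hq⟩ := nbhd_eq_true_cons hn (.wrap x u hu hbf) hv h
    rw [hcount] at h
    obtain ⟨v', hv', hvw, hvv | ⟨hvv, hN⟩⟩ := (hv.isBraidFree hM).peel
      (typeD n).toCoxeterSystem hM (hv.wordProd_mul_self _ hM) hq
    · obtain ⟨p, hp, hvp⟩ := hv'.exists_isPalindromic (typeD n).toCoxeterSystem hM _ rfl hvw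
      have := ih hp (hcount.mpr fun y => ?_)
      · exact ((this.append_right [x]).cons x).trans
          (((hvp.symm.append_right [x]).cons x).trans hvv.symm)
      · have h₁ := h y
        rw [hvv.perm.count_eq] at h₁
        rw [← hvp.perm.count_eq]
        simpa [List.count_cons] using h₁
    · have h₁ := h x
      rw [hvv.perm.count_eq] at h₁
      have := List.count_eq_zero.mpr (notMem_of_nbhd_eq_nil hN)
      simp [this] at h₁
  | central x u hu hx ih =>
    intro v hv h
    obtain ⟨q, hq⟩ := nbhd_eq_true_cons hn (.central x u hu hx) hv h
    rw [hcount] at h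
    obtain ⟨v', hv', hvw, hvv | ⟨hvv, hN⟩⟩ := (hv.isBraidFree hM).peel
      (typeD n).toCoxeterSystem hM (hv.wordProd_mul_self _ hM) hq
    · have h₁ := h x
      rw [hvv.perm.count_eq] at h₁
      have := List.count_eq_zero.mpr (notMem_of_nbhd_eq_nil hx)
      simp [this] at h₁
    · obtain ⟨p, hp, hvp⟩ := hv'.exists_isPalindromic (typeD n).toCoxeterSystem hM _ rfl hvw
      have := ih hp (hcount.mpr fun y => ?_)
      · exact (this.cons x).trans ((hvp.symm.cons x).trans hvv.symm)
      · have h₁ := h y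
        rw [hvv.perm.count_eq] at h₁
        rw [← hvp.perm.count_eq]
        simpa [List.count_cons] using h₁

end CoxeterMatrix

theorem card_fcInvolutions_eq_card_isValidCount {n : ℕ} (hn : 1 ≤ n) :
    Nat.card {w : (typeD n).Group // IsFCInvolution (typeD n).toCoxeterSystem w} =
      Nat.card {c // IsValidCount n c} := by
  have hM := typeD_isSimplyLaced n
  set cs := (typeD n).toCoxeterSystem
  choose u hu huc using fun c : {c // IsValidCount n c} => c.2.exists_isPalindromic hn _ rfl
  refine (Nat.card_eq_of_bijective (fun c => ⟨cs.wordProd (u c),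
    (cs.isFullyCommutative_iff hM _).mpr ⟨u c, (hu c).isBraidFree hM, rfl⟩,
    (hu c).wordProd_mul_self cs hM⟩) ⟨fun c d h => ?_, fun ⟨w, hw, hww⟩ => ?_⟩).symm
  · have h₁ := (cs.commEquiv_of_isBraidFree hM ((hu c).isBraidFree hM) ((hu d).isBraidFree hM)
      (congrArg Subtype.val h)).perm
    refine Subtype.ext ?_
    rw [← huc c, ← huc d]
    ext j
    exact (h₁.map _).count_eq j
  · obtain ⟨v, hv, rfl⟩ := (cs.isFullyCommutative_iff hM _).mp hw
    obtain ⟨p, hp, hvp⟩ := hv.exists_isPalindromic cs hM _ rfl hww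
    refine ⟨⟨_, (hp.isValidCount_and_hasLeads hn).1⟩, Subtype.ext ?_⟩
    exact (((hu _).commEquiv_of_count_eq hn hp (huc _)).trans hvp.symm).wordProd_eq cs

end TypeDWords

section TypeDEnumeration

open Finset Function

/-- Nonnegative lattice paths of length `m` from `0` to `h`, with steps `1`, `-1`, and steps `0`
at height `0`. -/
structure IsPath (m h : ℕ) (c : ℕ → ℕ) : Prop where
  zero : c 0 = 0
  outside : ∀ j, m < j → c j = 0
  last : c m = h
  step : ∀ j, j < m → IsStep (c j) (c (j + 1)) ∧ ¬ IsZig (c j) (c (j + 1))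

/-- Counts on the chain in which the pattern `0, 2` or `2, 2` occurs. -/
structure IsZigPath (m : ℕ) (c : ℕ → ℕ) : Prop where
  zero : c 0 = 0
  outside : ∀ j, m < j → c j = 0
  step : ∀ j, j < m → IsStep (c j) (c (j + 1))
  zig : ∀ j, j + 1 < m → IsZig (c j) (c (j + 1)) → c (j + 2) = 2
  exists_zig : ∃ j, j < m ∧ IsZig (c j) (c (j + 1))

theorem IsZig.propagate {m j : ℕ} {c : ℕ → ℕ}
    (h : ∀ j, j + 1 < m → IsZig (c j) (c (j + 1)) → c (j + 2) = 2)
    (hz : IsZig (c j) (c (j + 1))) : ∀ d, j + d < m → IsZig (c (j + d)) (c (j + d + 1)) := by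
  intro d
  induction d with
  | zero => exact fun _ => hz
  | succ d ih =>
    intro hd
    have h₁ := ih (by omega)
    exact ⟨h _ (by omega) h₁, .inr h₁.1⟩

theorem IsZigPath.isZig_last {m : ℕ} {c : ℕ → ℕ} (h : IsZigPath (m + 1) c) :
    IsZig (c m) (c (m + 1)) := by
  obtain ⟨j, hj, hz⟩ := h.exists_zig
  have := IsZig.propagate h.zig hz (m - j) (by omega)
  rwa [Nat.add_sub_cancel' (by omega)] at this

theorem IsZigPath.last {m : ℕ} {c : ℕ → ℕ} (h : IsZigPath m c) : c m = 2 := by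
  cases m with
  | zero => obtain ⟨j, hj, -⟩ := h.exists_zig; omega
  | succ m => exact h.isZig_last.1

theorem isPath_succ_iff {m h : ℕ} {c : ℕ → ℕ} : IsPath (m + 1) h c ↔ c (m + 1) = h ∧
    ∃ k, (IsStep k h ∧ ¬ IsZig k h) ∧ IsPath m k (update c (m + 1) 0) := by
  have hu : ∀ j, j ≤ m → update c (m + 1) 0 j = c j := fun j hj => update_of_ne (by omega) _ _
  constructor
  · rintro ⟨z, o, la, st⟩
    refine ⟨la, c m, la ▸ st m (by omega), ?_, ?_, ?_, ?_⟩
    · rw [hu 0 (by omega), z]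
    · intro j hj
      by_cases hj' : j = m + 1
      · rw [hj', update_self]
      · rw [update_of_ne hj', o j (by omega)]
    · rw [hu m le_rfl]
    · intro j hj
      rw [hu j (by omega), hu (j + 1) (by omega)]
      exact st j (by omega)
  · rintro ⟨la, k, hk, z, o, rfl, st⟩
    refine ⟨?_, ?_, la, ?_⟩
    · rw [← hu 0 (by omega), z]
    · intro j hj
      rw [← o j (by omega), update_of_ne (by omega)]
    · intro j hj
      by_cases hj' : j = m
      · subst hj'
        rw [la, ← hu j le_rfl]
        exact hk
      · rw [← hu j (by omega), ← hu (j + 1) (by omega)]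
        exact st j (by omega)

theorem isZigPath_succ_iff {m : ℕ} {c : ℕ → ℕ} : IsZigPath (m + 1) c ↔ c (m + 1) = 2 ∧
    (IsPath m 0 (update c (m + 1) 0) ∨ IsPath m 2 (update c (m + 1) 0) ∨
      IsZigPath m (update c (m + 1) 0)) := by
  have hu : ∀ j, j ≤ m → update c (m + 1) 0 j = c j := fun j hj => update_of_ne (by omega) _ _
  constructor
  · intro h
    refine ⟨h.last, ?_⟩
    have z : update c (m + 1) 0 0 = 0 := by rw [hu 0 (by omega), h.zero]
    have o : ∀ j, m < j → update c (m + 1) 0 j = 0 := by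
      intro j hj
      by_cases hj' : j = m + 1
      · rw [hj', update_self]
      · rw [update_of_ne hj', h.outside j (by omega)]
    by_cases hz : ∃ j, j < m ∧ IsZig (c j) (c (j + 1))
    · refine .inr (.inr ⟨z, o, ?_, ?_, ?_⟩)
      · intro j hj
        rw [hu j (by omega), hu (j + 1) (by omega)]
        exact h.step j (by omega)
      · intro j hj
        rw [hu j (by omega), hu (j + 1) (by omega), hu (j + 2) (by omega)]
        exact h.zig j (by omega)
      · obtain ⟨j, hj, hz⟩ := hz
        refine ⟨j, hj, ?_⟩
        rwa [hu j (by omega), hu (j + 1) (by omega)]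
    · push Not at hz
      have key : IsPath m (c m) (update c (m + 1) 0) := by
        refine ⟨z, o, hu m le_rfl, ?_⟩
        intro j hj
        rw [hu j (by omega), hu (j + 1) (by omega)]
        exact ⟨h.step j (by omega), hz j hj⟩
      rcases h.isZig_last.2 with h' | h' <;> rw [h'] at key
      · exact .inl key
      · exact .inr (.inl key)
  · rintro ⟨la, h⟩
    have key : ∀ k, k = 0 ∨ k = 2 → IsPath m k (update c (m + 1) 0) → IsZigPath (m + 1) c := by
      rintro k hk ⟨z, o, la', st⟩
      have hz : IsZig (c m) (c (m + 1)) := by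
        rw [la, ← hu m le_rfl, la']
        exact ⟨rfl, hk⟩
      refine ⟨?_, ?_, ?_, ?_, m, by omega, hz⟩
      · rw [← hu 0 (by omega), z]
      · intro j hj
        rw [← o j (by omega), update_of_ne (by omega)]
      · intro j hj
        by_cases hj' : j = m
        · subst hj'
          exact .inr (.inr (.inr hz))
        · rw [← hu j (by omega), ← hu (j + 1) (by omega)]
          exact (st j (by omega)).1
      · intro j hj hz'
        rw [← hu j (by omega), ← hu (j + 1) (by omega)] at hz'
        exact absurd hz' (st j (by omega)).2
    rcases h with h | h | h
    · exact key 0 (.inl rfl) h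
    · exact key 2 (.inr rfl) h
    · have hm := h.last
      rw [hu m le_rfl] at hm
      refine ⟨?_, ?_, ?_, ?_, m, by omega, la, .inr hm⟩
      · rw [← hu 0 (by omega), h.zero]
      · intro j hj
        rw [← h.outside j (by omega), update_of_ne (by omega)]
      · intro j hj
        by_cases hj' : j = m
        · subst hj'
          exact .inr (.inr (.inr ⟨la, .inr hm⟩))
        · rw [← hu j (by omega), ← hu (j + 1) (by omega)]
          exact h.step j (by omega)
      · intro j hj hz'
        by_cases hj' : j + 1 = m
        · subst hj'
          exact la
        · rw [← hu j (by omega), ← hu (j + 1) (by omega)] at hz'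
          rw [← hu (j + 2) (by omega)]
          exact h.zig j (by omega) hz'

theorem isValidCount_succ_iff {m : ℕ} {c : ℕ → ℕ} : IsValidCount (m + 1) c ↔
    (∃ h, IsPath m h (update (update c (m + 1) 0) (m + 2) 0) ∧
      IsLeafPair h (c (m + 1)) (c (m + 2))) ∨
    (IsZigPath m (update (update c (m + 1) 0) (m + 2) 0) ∧ c (m + 1) = 1 ∧ c (m + 2) = 1) := by
  set c₀ := update (update c (m + 1) 0) (m + 2) 0 with hc₀
  have hu : ∀ j, j ≠ m + 1 → j ≠ m + 2 → c₀ j = c j := fun j hj hj' => by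
    rw [hc₀, update_of_ne hj', update_of_ne hj]
  have hu' : ∀ j, j = m + 1 ∨ j = m + 2 → c₀ j = 0 := by
    rintro j (rfl | rfl) <;> simp [hc₀]
  constructor
  · intro h
    have z : c₀ 0 = 0 := by rw [hu 0 (by omega) (by omega), h.zero]
    have o : ∀ j, m < j → c₀ j = 0 := by
      intro j hj
      by_cases hj' : j = m + 1 ∨ j = m + 2
      · exact hu' j hj'
      · rw [hu j (by omega) (by omega), h.outside j (by omega)]
    by_cases hz : ∃ j, j < m ∧ IsZig (c j) (c (j + 1))
    · have key : IsZigPath m c₀ := by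
        refine ⟨z, o, ?_, ?_, ?_⟩
        · intro j hj
          rw [hu j (by omega) (by omega), hu (j + 1) (by omega) (by omega)]
          exact h.step j (by omega)
        · intro j hj
          rw [hu j (by omega) (by omega), hu (j + 1) (by omega) (by omega),
            hu (j + 2) (by omega) (by omega)]
          exact h.zig j (by omega)
        · obtain ⟨j, hj, hz⟩ := hz
          refine ⟨j, hj, ?_⟩
          rwa [hu j (by omega) (by omega), hu (j + 1) (by omega) (by omega)]
      refine .inr ⟨key, ?_⟩
      obtain ⟨j, rfl⟩ : ∃ j, m = j + 1 := ⟨m - 1, by have := key.exists_zig; omega⟩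
      have hz' := key.isZig_last
      rw [hu j (by omega) (by omega), hu (j + 1) (by omega) (by omega)] at hz'
      exact h.zig_leaf j rfl hz'
    · push Not at hz
      refine .inl ⟨c m, ⟨z, o, hu m (by omega) (by omega), ?_⟩, h.leaf m rfl⟩
      intro j hj
      rw [hu j (by omega) (by omega), hu (j + 1) (by omega) (by omega)]
      exact ⟨h.step j (by omega), hz j hj⟩
  · rintro (⟨h, ⟨z, o, rfl, st⟩, hl⟩ | ⟨h, hl⟩)
    · rw [hu m (by omega) (by omega)] at hl
      refine ⟨?_, ?_, ?_, ?_, ?_, ?_⟩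
      · rw [← hu 0 (by omega) (by omega), z]
      · intro j hj
        rw [← hu j (by omega) (by omega), o j (by omega)]
      · intro j hj
        rw [← hu j (by omega) (by omega), ← hu (j + 1) (by omega) (by omega)]
        exact (st j (by omega)).1
      · intro j hj hz
        rw [← hu j (by omega) (by omega), ← hu (j + 1) (by omega) (by omega)] at hz
        exact absurd hz (st j (by omega)).2
      · intro b hb
        obtain rfl : b = m := by omega
        exact hl
      · intro j hj hz
        rw [← hu j (by omega) (by omega), ← hu (j + 1) (by omega) (by omega)] at hz
        exact absurd hz (st j (by omega)).2
    · refine ⟨?_, ?_, ?_, ?_, ?_, ?_⟩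
      · rw [← hu 0 (by omega) (by omega), h.zero]
      · intro j hj
        rw [← hu j (by omega) (by omega), h.outside j (by omega)]
      · intro j hj
        rw [← hu j (by omega) (by omega), ← hu (j + 1) (by omega) (by omega)]
        exact h.step j (by omega)
      · intro j hj hz
        rw [← hu j (by omega) (by omega), ← hu (j + 1) (by omega) (by omega)] at hz
        rw [← hu (j + 2) (by omega) (by omega)]
        exact h.zig j (by omega) hz
      · intro b hb
        obtain rfl : b = m := by omega
        have := h.last
        rw [hu b (by omega) (by omega)] at this
        rw [this, hl.1, hl.2]
        simp [IsLeafPair, IsLeafStep]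
      · exact fun _ _ _ => hl

open scoped Classical in
/-- The finite set of paths of length `m` ending at `h`. -/
noncomputable def pathFinset : ℕ → ℕ → Finset (ℕ → ℕ)
  | 0, h => if h = 0 then {0} else ∅
  | m + 1, 0 => (pathFinset m 0 ∪ pathFinset m 1).image (update · (m + 1) 0)
  | m + 1, h + 1 => (pathFinset m h ∪ pathFinset m (h + 2)).image (update · (m + 1) (h + 1))

open scoped Classical in
/-- The finite set of counts on a chain of length `m` with the pattern `0, 2` or `2, 2`. -/
noncomputable def zigFinset : ℕ → Finset (ℕ → ℕ)
  | 0 => ∅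
  | m + 1 => (pathFinset m 0 ∪ (pathFinset m 2 ∪ zigFinset m)).image (update · (m + 1) 2)

theorem mem_image_update {s : Finset (ℕ → ℕ)} {m h : ℕ} (hs : ∀ c ∈ s, c m = 0) {c : ℕ → ℕ}
    [DecidableEq (ℕ → ℕ)] :
    c ∈ s.image (update · m h) ↔ c m = h ∧ update c m 0 ∈ s := by
  rw [mem_image]
  constructor
  · rintro ⟨d, hd, rfl⟩
    refine ⟨update_self .., ?_⟩
    rwa [update_idem, ← hs d hd, update_eq_self]
  · rintro ⟨rfl, hc⟩
    exact ⟨_, hc, by simp⟩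

theorem card_image_update {s : Finset (ℕ → ℕ)} {m h : ℕ} (hs : ∀ c ∈ s, c m = 0)
    [DecidableEq (ℕ → ℕ)] : (s.image (update · m h)).card = s.card := by
  refine card_image_of_injOn fun c hc d hd hcd => ?_
  have := congrArg (update · m 0) hcd
  simp only [update_idem] at this
  have h₁ := hs c hc
  have h₂ := hs d hd
  rwa [← h₁, update_eq_self, h₁, ← h₂, update_eq_self] at this

theorem mem_pathFinset {m h : ℕ} {c : ℕ → ℕ} : c ∈ pathFinset m h ↔ IsPath m h c := by
  classical
  induction m generalizing h c with
  | zero =>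
    rw [pathFinset]
    constructor
    · split_ifs with hh
      · rw [mem_singleton]
        rintro rfl
        exact ⟨rfl, fun _ _ => rfl, hh.symm, fun j hj => by omega⟩
      · simp
    · rintro ⟨z, o, la, -⟩
      rw [if_pos (by rw [← la, z]), mem_singleton]
      ext j
      rcases Nat.eq_zero_or_pos j with rfl | hj
      · exact z
      · exact o j hj
  | succ m ih =>
    rw [isPath_succ_iff]
    cases h with
    | zero =>
      rw [pathFinset, mem_image_update, mem_union, ih, ih]
      · refine and_congr_right fun _ => ⟨?_, ?_⟩
        · rintro (h | h)
          · exact ⟨0, by simp [IsStep, IsZig], h⟩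
          · exact ⟨1, by simp [IsStep, IsZig], h⟩
        · rintro ⟨k, hk, h⟩
          obtain rfl | rfl : k = 0 ∨ k = 1 := by unfold IsStep IsZig at hk; omega
          exacts [.inl h, .inr h]
      · intro c hc
        rw [mem_union, ih, ih] at hc
        rcases hc with hc | hc <;> exact hc.outside _ (by omega)
    | succ h =>
      rw [pathFinset, mem_image_update, mem_union, ih, ih]
      · refine and_congr_right fun _ => ⟨?_, ?_⟩
        · rintro (h' | h')
          · exact ⟨h, by unfold IsStep IsZig; omega, h'⟩
          · exact ⟨h + 2, by unfold IsStep IsZig; omega, h'⟩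
        · rintro ⟨k, hk, h'⟩
          obtain rfl | rfl : k = h ∨ k = h + 2 := by unfold IsStep IsZig at hk; omega
          exacts [.inl h', .inr h']
      · intro c hc
        rw [mem_union, ih, ih] at hc
        rcases hc with hc | hc <;> exact hc.outside _ (by omega)

theorem pathFinset_outside {m h j : ℕ} (hj : m < j) : ∀ c ∈ pathFinset m h, c j = 0 :=
  fun _ hc => (mem_pathFinset.mp hc).outside _ hj

theorem mem_zigFinset {m : ℕ} {c : ℕ → ℕ} : c ∈ zigFinset m ↔ IsZigPath m c := by
  classical
  induction m generalizing c with
  | zero =>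
    rw [zigFinset]
    refine ⟨by simp, fun h => ?_⟩
    obtain ⟨j, hj, -⟩ := h.exists_zig
    omega
  | succ m ih =>
    rw [isZigPath_succ_iff, zigFinset, mem_image_update, mem_union, mem_union, ih, mem_pathFinset,
      mem_pathFinset]
    intro c hc
    rw [mem_union, mem_union, ih] at hc
    rcases hc with hc | hc | hc
    · exact pathFinset_outside (by omega) _ hc
    · exact pathFinset_outside (by omega) _ hc
    · exact hc.outside _ (by omega)

theorem disjoint_pathFinset {m h k : ℕ} (hk : h ≠ k) :
    Disjoint (pathFinset m h) (pathFinset m k) := by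
  rw [disjoint_left]
  intro c h₁ h₂
  exact hk ((mem_pathFinset.mp h₁).last.symm.trans (mem_pathFinset.mp h₂).last)

theorem disjoint_pathFinset_zigFinset {m h : ℕ} : Disjoint (pathFinset m h) (zigFinset m) := by
  rw [disjoint_left]
  intro c h₁ h₂
  obtain ⟨j, hj, hz⟩ := (mem_zigFinset.mp h₂).exists_zig
  exact ((mem_pathFinset.mp h₁).step j hj).2 hz

theorem card_pathFinset_succ_zero (m : ℕ) : (pathFinset (m + 1) 0).card =
    (pathFinset m 0).card + (pathFinset m 1).card := by
  classical
  rw [pathFinset, card_image_update, card_union_of_disjoint (disjoint_pathFinset (by omega))]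
  intro c hc
  rcases mem_union.mp hc with hc | hc <;> exact pathFinset_outside (by omega) _ hc

theorem card_pathFinset_succ_succ (m h : ℕ) : (pathFinset (m + 1) (h + 1)).card =
    (pathFinset m h).card + (pathFinset m (h + 2)).card := by
  classical
  rw [pathFinset, card_image_update, card_union_of_disjoint (disjoint_pathFinset (by omega))]
  intro c hc
  rcases mem_union.mp hc with hc | hc <;> exact pathFinset_outside (by omega) _ hc

theorem card_pathFinset (m h : ℕ) :
    (pathFinset m h).card = if h ≤ m then m.choose ((m - h) / 2) else 0 := by
  induction m generalizing h with
  | zero =>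
    rw [pathFinset]
    rcases Nat.eq_zero_or_pos h with rfl | hh
    · simp
    · simp [hh.ne']
  | succ m ih =>
    cases h with
    | zero =>
      rw [card_pathFinset_succ_zero, ih, ih]
      rcases Nat.even_or_odd' m with ⟨k, rfl | rfl⟩
      · rcases k with _ | k
        · simp
        · rw [if_pos (by omega), if_pos (by omega), if_pos (by omega),
            (by omega : (2 * (k + 1) - 0) / 2 = k + 1), (by omega : (2 * (k + 1) - 1) / 2 = k),
            (by omega : (2 * (k + 1) + 1 - 0) / 2 = k + 1), Nat.choose_succ_succ', add_comm]
      · rw [if_pos (by omega), if_pos (by omega), if_pos (by omega),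
          (by omega : (2 * k + 1 - 0) / 2 = k), (by omega : (2 * k + 1 - 1) / 2 = k),
          (by omega : (2 * k + 1 + 1 - 0) / 2 = k + 1), Nat.choose_succ_succ',
          Nat.choose_symm_half]
    | succ h =>
      rw [card_pathFinset_succ_succ, ih, ih, Nat.add_sub_add_right]
      simp only [Nat.add_le_add_iff_right]
      split_ifs with h₁ h₂
      · obtain ⟨k, hk⟩ : ∃ k, (m - h) / 2 = k + 1 := ⟨(m - h) / 2 - 1, by omega⟩
        rw [hk, Nat.choose_succ_succ', (by omega : (m - (h + 2)) / 2 = k), add_comm]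
      · rw [(by omega : (m - h) / 2 = 0)]
        simp
      · omega
      · rfl

theorem card_zigFinset (m : ℕ) : (zigFinset m).card + 1 = (pathFinset (m + 1) 0).card := by
  classical
  induction m with
  | zero => simp [zigFinset, card_pathFinset]
  | succ m ih =>
    rw [zigFinset, card_image_update, card_union_of_disjoint, card_union_of_disjoint,
      card_pathFinset_succ_zero, card_pathFinset_succ_succ, ← ih, Nat.zero_add]
    · omega
    · exact disjoint_pathFinset_zigFinset
    · exact disjoint_union_right.mpr
        ⟨disjoint_pathFinset (by omega), disjoint_pathFinset_zigFinset⟩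
    · intro c hc
      rw [mem_union, mem_union, mem_zigFinset] at hc
      rcases hc with hc | hc | hc
      · exact pathFinset_outside (by omega) _ hc
      · exact pathFinset_outside (by omega) _ hc
      · exact hc.outside _ (by omega)

instance : DecidableRel IsLeafStep := fun _ _ => by unfold IsLeafStep; infer_instance

instance (k e f : ℕ) : Decidable (IsLeafPair k e f) := by unfold IsLeafPair; infer_instance

/-- The pairs of counts at the leaves when the branch vertex has count `k`. -/
def leafFinset (k : ℕ) : Finset (ℕ × ℕ) :=
  (range (k + 2) ×ˢ range (k + 2)).filter fun p => IsLeafPair k p.1 p.2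

theorem mem_leafFinset {k : ℕ} {p : ℕ × ℕ} : p ∈ leafFinset k ↔ IsLeafPair k p.1 p.2 := by
  rw [leafFinset, mem_filter, mem_product, mem_range, mem_range, and_iff_right_iff_imp]
  unfold IsLeafPair IsLeafStep
  omega

theorem card_leafFinset_even (k : ℕ) :
    (leafFinset (2 * k)).card = 4 + if k = 1 then 1 else 0 := by
  rcases (by omega : k = 0 ∨ k = 1 ∨ 2 ≤ k) with rfl | rfl | hk
  · decide
  · decide
  · have : leafFinset (2 * k) = {(k, k + 1), (k, k - 1), (k + 1, k), (k - 1, k)} := by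
      ext ⟨e, f⟩
      rw [mem_leafFinset]
      simp only [mem_insert, mem_singleton, Prod.mk.injEq]
      unfold IsLeafPair IsLeafStep
      omega
    rw [this, if_neg (by omega), card_insert_of_notMem, card_insert_of_notMem,
      card_insert_of_notMem, card_singleton]
    all_goals simp
    all_goals omega

theorem card_leafFinset_odd (k : ℕ) :
    (leafFinset (2 * k + 1)).card = if k = 0 then 1 else 0 := by
  split_ifs with hk
  · subst hk
    decide
  · rw [card_eq_zero, eq_empty_iff_forall_notMem]
    intro p hp
    rw [mem_leafFinset] at hp
    unfold IsLeafPair IsLeafStep at hp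
    omega

open scoped Classical in
theorem card_isValidCount_succ (m : ℕ) : Nat.card {c // IsValidCount (m + 1) c} =
    ∑ h ∈ range (m + 1), (pathFinset m h).card * (leafFinset h).card + (zigFinset m).card := by
  have hle : ∀ h, m < h → pathFinset m h = ∅ := fun h hh => by
    rw [← card_eq_zero, card_pathFinset, if_neg (by omega)]
  set X : Finset ((ℕ → ℕ) × ℕ × ℕ) :=
    ((range (m + 1)).biUnion fun h => pathFinset m h ×ˢ leafFinset h) ∪
      zigFinset m ×ˢ {(1, 1)} with hX
  have hmem : ∀ c e f, (c, e, f) ∈ X ↔ (∃ h, IsPath m h c ∧ IsLeafPair h e f) ∨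
      (IsZigPath m c ∧ e = 1 ∧ f = 1) := by
    intro c e f
    simp only [hX, mem_union, mem_biUnion, mem_product, mem_pathFinset, mem_leafFinset,
      mem_zigFinset, mem_singleton, Prod.mk.injEq, mem_range]
    refine or_congr_left (exists_congr fun h => and_iff_right_of_imp fun h' => ?_)
    by_contra hh
    have := mem_pathFinset.mpr h'.1
    rw [hle h (by omega)] at this
    simp at this
  have hout : ∀ c e f, (c, e, f) ∈ X → ∀ j, m < j → c j = 0 := by
    intro c e f h j hj
    rcases (hmem c e f).mp h with ⟨_, h, -⟩ | ⟨h, -⟩ <;> exact h.outside j hj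
  have hcard : X.card = ∑ h ∈ range (m + 1), (pathFinset m h).card * (leafFinset h).card +
      (zigFinset m).card := by
    rw [hX, card_union_of_disjoint, card_biUnion]
    · simp [card_product]
    · intro h _ k _ hk
      exact disjoint_product.mpr (.inl (disjoint_pathFinset hk))
    · rw [disjoint_biUnion_left]
      exact fun h _ => disjoint_product.mpr (.inl disjoint_pathFinset_zigFinset)
  rw [← hcard, ← Fintype.card_coe, ← Nat.card_eq_fintype_card]
  refine Nat.card_congr
    { toFun := fun c => ⟨(update (update c.1 (m + 1) 0) (m + 2) 0, c.1 (m + 1), c.1 (m + 2)),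
        (hmem _ _ _).mpr (isValidCount_succ_iff.mp c.2)⟩
      invFun := fun x => ⟨update (update x.1.1 (m + 1) x.1.2.1) (m + 2) x.1.2.2, ?_⟩
      left_inv := ?_
      right_inv := ?_ }
  · obtain ⟨⟨c, e, f⟩, hx⟩ := x
    have h₁ := hout _ _ _ hx (m + 1) (by omega)
    have h₂ := hout _ _ _ hx (m + 2) (by omega)
    have : update (update (update (update c (m + 1) e) (m + 2) f) (m + 1) 0) (m + 2) 0 = c := by
      ext j
      simp only [update_apply]
      split_ifs with h₃ h₄
      · rw [h₃, h₂]
      · rw [h₄, h₁]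
      · rfl
    rw [isValidCount_succ_iff, this]
    simpa [update_apply] using (hmem c e f).mp hx
  · rintro ⟨c, hc⟩
    ext j
    simp only [update_apply]
    split_ifs with h₃ h₄
    · rw [h₃]
    · rw [h₄]
    · rfl
  · rintro ⟨⟨c, e, f⟩, hx⟩
    have h₁ := hout _ _ _ hx (m + 1) (by omega)
    have h₂ := hout _ _ _ hx (m + 2) (by omega)
    simp only [Subtype.mk.injEq, Prod.mk.injEq]
    refine ⟨?_, by simp, by simp⟩
    ext j
    simp only [update_apply]
    split_ifs with h₃ h₄
    · rw [h₃, h₂]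
    · rw [h₄, h₁]
    · rfl

end TypeDEnumeration

section TypeDFormula

open Finset

theorem sum_range_two_mul {M : Type*} [AddCommMonoid M] (f : ℕ → M) (k : ℕ) :
    ∑ i ∈ range (2 * k), f i = ∑ i ∈ range k, (f (2 * i) + f (2 * i + 1)) := by
  induction k with
  | zero => rfl
  | succ k ih => rw [sum_range_succ, ← ih, Nat.mul_succ, sum_range_succ, sum_range_succ, add_assoc]

theorem sum_range_choose_succ_add (n k : ℕ) :
    ∑ i ∈ range (k + 1), (n + 1).choose i + n.choose k =
      2 * ∑ i ∈ range (k + 1), n.choose i := by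
  induction k with
  | zero => simp
  | succ k ih =>
    rw [sum_range_succ, sum_range_succ _ (k + 1), Nat.choose_succ_succ']
    omega

theorem two_mul_sum_range_choose_two_mul (k : ℕ) :
    2 * ∑ i ∈ range (k + 1), (2 * k).choose i = 4 ^ k + (2 * k).choose k := by
  rw [← sum_range_choose_succ_add, Nat.sum_range_choose_halfway]

/-- The leaf counts select the paths ending at an even height, with a correction at heights
`1` and `2`. -/
theorem sum_card_pathFinset_mul_card_leafFinset {m k : ℕ} (hm : m / 2 = k) :
    ∑ h ∈ range (m + 1), (pathFinset m h).card * (leafFinset h).card =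
      4 * ∑ i ∈ range (k + 1), m.choose i + (pathFinset m 1).card + (pathFinset m 2).card := by
  have hE : ∑ t ∈ range (k + 1), (pathFinset m (2 * t)).card =
      ∑ i ∈ range (k + 1), m.choose i := by
    rw [← sum_range_reflect]
    refine sum_congr rfl fun i hi => ?_
    rw [mem_range] at hi
    rw [card_pathFinset, if_pos (by omega)]
    congr 1
    omega
  have hext : ∑ h ∈ range (m + 1), (pathFinset m h).card * (leafFinset h).card =
      ∑ h ∈ range (2 * (k + 1)), (pathFinset m h).card * (leafFinset h).card := by
    refine sum_subset (range_mono (by omega)) fun h _ hh => ?_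
    rw [mem_range] at hh
    rw [card_pathFinset, if_neg (by omega), zero_mul]
  have h2 : (if 1 < k + 1 then (pathFinset m 2).card else 0) = (pathFinset m 2).card := by
    split_ifs with hk
    · rfl
    · rw [card_pathFinset, if_neg (by omega)]
  rw [hext, sum_range_two_mul, ← hE]
  simp only [card_leafFinset_even, card_leafFinset_odd, mul_add, mul_ite, mul_one, mul_zero,
    sum_add_distrib, sum_ite_eq', mem_range]
  rw [h2, ← sum_mul]
  simp
  omega

theorem card_isValidCount_succ_add_one {m k : ℕ} (hm : m / 2 = k) :
    Nat.card {c // IsValidCount (m + 1) c} + 1 + m.choose k =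
      4 * ∑ i ∈ range (k + 1), m.choose i + (m + 2).choose (k + 1) + (pathFinset m 1).card := by
  have h₁ := card_zigFinset m
  have h₂ : (pathFinset (m + 2) 0).card = (pathFinset (m + 1) 0).card +
      (pathFinset (m + 1) 1).card := card_pathFinset_succ_zero (m + 1)
  have h₃ := card_pathFinset_succ_zero m
  have h₄ := card_pathFinset_succ_succ m 0
  have h₅ := card_pathFinset m 0
  have h₆ := card_pathFinset (m + 2) 0
  rw [if_pos (Nat.zero_le _), Nat.sub_zero] at h₅ h₆
  rw [hm] at h₅
  rw [(by omega : (m + 2) / 2 = k + 1)] at h₆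
  rw [Nat.zero_add, Nat.zero_add] at h₄
  rw [card_isValidCount_succ, sum_card_pathFinset_mul_card_leafFinset hm]
  omega

end TypeDFormula

/-- The number `N` of fully commutative involutions in the Coxeter group of type `D_{n+1}`
satisfies: `N = 2^n + C(n+1, n/2) - 1` if `n` is even, and
`2·N = 2^(n+1) + 3·C(n+1, (n+1)/2) - 2` if `n` is odd. -/
theorem card_fcInvolutions_typeD (n : ℕ) (hn : 1 ≤ n) :
    (Even n →
      Nat.card {w : (typeD n).Group // IsFCInvolution (typeD n).toCoxeterSystem w} =
        2 ^ n + Nat.choose (n + 1) (n / 2) - 1) ∧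
    (Odd n →
      2 * Nat.card {w : (typeD n).Group // IsFCInvolution (typeD n).toCoxeterSystem w} =
        2 ^ (n + 1) + 3 * Nat.choose (n + 1) ((n + 1) / 2) - 2) := by
  rw [card_fcInvolutions_eq_card_isValidCount hn]
  constructor
  · rintro ⟨l, hl⟩
    obtain ⟨k, rfl⟩ : ∃ k, n = 2 * k + 1 + 1 := ⟨l - 1, by omega⟩
    have h := card_isValidCount_succ_add_one (by omega : (2 * k + 1) / 2 = k)
    rw [Nat.sum_range_choose_halfway, card_pathFinset, if_pos (by omega),
      (by omega : (2 * k + 1 - 1) / 2 = k)] at h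
    rw [(by omega : (2 * k + 1 + 1) / 2 = k + 1),
      (by rw [← mul_one (2 * k), pow_add, pow_add, mul_one, pow_mul]; norm_num; ring :
        2 ^ (2 * k + 1 + 1) = 4 * 4 ^ k)]
    have h₁ : (2 * k + 1 + 2).choose (k + 1) = (2 * k + 1 + 1 + 1).choose (k + 1) := rfl
    omega
  · rintro ⟨k, rfl⟩
    have h := card_isValidCount_succ_add_one (by omega : (2 * k) / 2 = k)
    have h₁ := two_mul_sum_range_choose_two_mul k
    have h₂ := card_pathFinset_succ_zero (2 * k)
    rw [card_pathFinset, card_pathFinset (2 * k) 0, if_pos (by omega), if_pos (by omega),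
      (by omega : (2 * k + 1 - 0) / 2 = k), (by omega : (2 * k - 0) / 2 = k)] at h₂
    have h₃ := Nat.choose_succ_succ' (2 * k + 1) k
    rw [Nat.choose_symm_half] at h₃
    rw [(by omega : (2 * k + 1 + 1) / 2 = k + 1),
      (by rw [pow_add, pow_add, pow_mul]; norm_num; ring : 2 ^ (2 * k + 1 + 1) = 4 * 4 ^ k)]
    have h₄ : (2 * k + 2).choose (k + 1) = (2 * k + 1 + 1).choose (k + 1) := rfl
    omega
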